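/- arXiv:0902.4454 — 6 statements merged into one kernel-verified Lean document; each statement's English description precedes it below -/
import Mathlib

section
/- Let n, m be positive integers and let f = xⁿyᵐ ∈ ℂ[x,y]. If n ≠ m, then the stabilizer Stab(f) ⊂ SL(2,ℂ) consists exactly of the diagonal matrices in SL(2,ℂ). If n = m, then Stab(f) consists exactly of the diagonal and the antidiagonal matrices in SL(2,ℂ). -/
open MvPolynomial Matrix

noncomputable section

/-- Polynomials in two variables `x = X 0`, `y = X 1` over `ℂ`. -/
abbrev BPoly : Type := MvPolynomial (Fin 2) ℂ

/-- The variable `x`. -/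
def Px : BPoly := X 0

/-- The variable `y`. -/
def Py : BPoly := X 1

/-- Substitution action of a 2×2 matrix on polynomials in two variables:
for `A = [[p,q],[r,s]]`, `(f·A)(x,y) = f(px+qy, rx+sy)`. -/
def matAct (A : Matrix (Fin 2) (Fin 2) ℂ) (f : BPoly) : BPoly :=
  bind₁ (fun i => C (A i 0) * Px + C (A i 1) * Py) f

/-- `f` is semi-invariant under `A`: `f·A = c·f` for some nonzero scalar `c`. -/
def SemiInv (A : Matrix (Fin 2) (Fin 2) ℂ) (f : BPoly) : Prop :=
  ∃ c : ℂ, c ≠ 0 ∧ matAct A f = C c * f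

/-- The stabilizer of `f` inside `SL(2,ℂ)`: all matrices under which `f` is
semi-invariant. -/
def Stab (f : BPoly) : Set (SpecialLinearGroup (Fin 2) ℂ) :=
  {A | SemiInv (A : Matrix (Fin 2) (Fin 2) ℂ) f}

/-- `f` is a (nonzero) binary form: nonzero and homogeneous of some degree. -/
def IsBinaryForm (f : BPoly) : Prop :=
  f ≠ 0 ∧ ∃ d : ℕ, f.IsHomogeneous d

/-- `f` is `SL(2,ℂ)`-equivalent to `g` up to a nonzero scalar:
`c·(f·A) = g` for some `A ∈ SL(2,ℂ)` and `c ≠ 0`. -/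
def EquivForm (f g : BPoly) : Prop :=
  ∃ A : SpecialLinearGroup (Fin 2) ℂ, ∃ c : ℂ, c ≠ 0 ∧
    C c * matAct (A : Matrix (Fin 2) (Fin 2) ℂ) f = g


theorem matAct_monomial (A : Matrix (Fin 2) (Fin 2) ℂ) (n m : ℕ) :
    matAct A (Px ^ n * Py ^ m) =
      (C (A 0 0) * Px + C (A 0 1) * Py) ^ n * (C (A 1 0) * Px + C (A 1 1) * Py) ^ m := by
  simp only [matAct, map_mul, map_pow]
  congr 2 <;> exact bind₁_X_right _ _

theorem eval_matAct_monomial {A : Matrix (Fin 2) (Fin 2) ℂ} {n m : ℕ} {c : ℂ}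
    (h : matAct A (Px ^ n * Py ^ m) = C c * (Px ^ n * Py ^ m)) (u v : ℂ) :
    (A 0 0 * u + A 0 1 * v) ^ n * (A 1 0 * u + A 1 1 * v) ^ m = c * (u ^ n * v ^ m) := by
  rw [matAct_monomial] at h
  simpa [Px, Py] using congrArg (eval ![u, v]) h

theorem semiInv_monomial_of_diagonal {A : Matrix (Fin 2) (Fin 2) ℂ} (hA : A.det = 1) (n m : ℕ)
    (h01 : A 0 1 = 0) (h10 : A 1 0 = 0) : SemiInv A (Px ^ n * Py ^ m) := by
  rw [det_fin_two, h01, zero_mul, sub_zero] at hA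
  have h0 : A 0 0 ≠ 0 := left_ne_zero_of_mul_eq_one hA
  have h1 : A 1 1 ≠ 0 := right_ne_zero_of_mul_eq_one hA
  refine ⟨A 0 0 ^ n * A 1 1 ^ m, mul_ne_zero (pow_ne_zero _ h0) (pow_ne_zero _ h1), ?_⟩
  rw [matAct_monomial, h01, h10]
  simp only [map_zero, map_mul, map_pow]
  ring

theorem semiInv_monomial_of_antidiagonal {A : Matrix (Fin 2) (Fin 2) ℂ} (hA : A.det = 1) (n : ℕ)
    (h00 : A 0 0 = 0) (h11 : A 1 1 = 0) : SemiInv A (Px ^ n * Py ^ n) := by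
  rw [det_fin_two, h00, zero_mul, zero_sub] at hA
  have h : A 0 1 * A 1 0 ≠ 0 := by
    intro h
    simp [h] at hA
  refine ⟨(A 0 1 * A 1 0) ^ n, pow_ne_zero _ h, ?_⟩
  rw [matAct_monomial, h00, h11]
  simp only [map_zero, map_mul, map_pow]
  ring

theorem diagonal_or_antidiagonal_of_semiInv_monomial {A : Matrix (Fin 2) (Fin 2) ℂ}
    (hA : A.det = 1) {n m : ℕ} (hn : 0 < n) (hm : 0 < m) (h : SemiInv A (Px ^ n * Py ^ m)) :
    (A 0 1 = 0 ∧ A 1 0 = 0) ∨ (A 0 0 = 0 ∧ A 1 1 = 0) := by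
  obtain ⟨c, -, h⟩ := h
  have hx : A 0 0 = 0 ∨ A 1 0 = 0 := by
    simpa [hn.ne', hm.ne'] using eval_matAct_monomial h 1 0
  have hy : A 0 1 = 0 ∨ A 1 1 = 0 := by
    simpa [hn.ne', hm.ne'] using eval_matAct_monomial h 0 1
  rw [det_fin_two] at hA
  rcases hx with hx | hx <;> rcases hy with hy | hy <;> simp_all

theorem eq_of_semiInv_monomial_of_antidiagonal {A : Matrix (Fin 2) (Fin 2) ℂ} {n m : ℕ}
    (h : SemiInv A (Px ^ n * Py ^ m)) (h00 : A 0 0 = 0) (h11 : A 1 1 = 0) : n = m := by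
  obtain ⟨c, hc, h⟩ := h
  have e1 := eval_matAct_monomial h 1 1
  have e2 := eval_matAct_monomial h 2 1
  simp only [h00, h11, zero_mul, zero_add, add_zero, mul_one, one_pow, mul_pow] at e1 e2
  rw [← mul_assoc, e1] at e2
  have e3 : (2 : ℂ) ^ m = 2 ^ n := mul_left_cancel₀ hc e2
  exact (Nat.pow_right_injective le_rfl (by exact_mod_cast e3)).symm

/-- The stabilizer of `f = xⁿyᵐ` in `SL(2,ℂ)` consists of the diagonal matrices
when `n ≠ m`, and of the diagonal and antidiagonal matrices when `n = m`. -/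
theorem stab_monomial (n m : ℕ) (hn : 0 < n) (hm : 0 < m) :
    (n ≠ m → Stab (Px ^ n * Py ^ m) =
      {A : SpecialLinearGroup (Fin 2) ℂ |
        (A : Matrix (Fin 2) (Fin 2) ℂ) 0 1 = 0 ∧
        (A : Matrix (Fin 2) (Fin 2) ℂ) 1 0 = 0}) ∧
    (n = m → Stab (Px ^ n * Py ^ m) =
      {A : SpecialLinearGroup (Fin 2) ℂ |
        ((A : Matrix (Fin 2) (Fin 2) ℂ) 0 1 = 0 ∧
         (A : Matrix (Fin 2) (Fin 2) ℂ) 1 0 = 0) ∨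
        ((A : Matrix (Fin 2) (Fin 2) ℂ) 0 0 = 0 ∧
         (A : Matrix (Fin 2) (Fin 2) ℂ) 1 1 = 0)}) := by
  refine ⟨fun hnm => Set.ext fun A => ⟨fun h => ?_, fun h => ?_⟩, ?_⟩
  · exact (diagonal_or_antidiagonal_of_semiInv_monomial A.det_coe hn hm h).resolve_right
      fun h' => hnm (eq_of_semiInv_monomial_of_antidiagonal h h'.1 h'.2)
  · exact semiInv_monomial_of_diagonal A.det_coe n m h.1 h.2
  · rintro rfl
    refine Set.ext fun A =>
      ⟨fun h => diagonal_or_antidiagonal_of_semiInv_monomial A.det_coe hn hm h, ?_⟩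
    rintro (h | h)
    · exact semiInv_monomial_of_diagonal A.det_coe n n h.1 h.2
    · exact semiInv_monomial_of_antidiagonal A.det_coe n h.1 h.2

end
end

section
/- Let f ∈ ℂ[x,y] be a binary form having at least three pairwise non-proportional linear factors (i.e. at least three distinct zeros in ℙ¹). Then the stabilizer Stab(f) = {A ∈ SL(2,ℂ) : f·A = c·f for some c ≠ 0} is a finite group. -/
open MvPolynomial Matrix

noncomputable section

theorem eval_matAct (A : Matrix (Fin 2) (Fin 2) ℂ) (f : BPoly) (v : Fin 2 → ℂ) :
    eval v (matAct A f) = eval (A *ᵥ v) f := by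
  rw [matAct, ← coe_aeval_eq_eval, RingHom.coe_coe, aeval_bind₁, ← coe_aeval_eq_eval,
    RingHom.coe_coe]
  congr 2
  funext i
  simp [Px, Py, Matrix.mulVec, dotProduct, Fin.sum_univ_two]

/-- The affine coordinate `y / x` of a vector, with `none` for the point at infinity `x = 0`. -/
def projSlope (v : Fin 2 → ℂ) : Option ℂ :=
  if v 0 = 0 then none else some (v 1 / v 0)

theorem cross_eq_of_projSlope_eq {u w : Fin 2 → ℂ} (h : projSlope u = projSlope w) :
    u 0 * w 1 = u 1 * w 0 := by
  unfold projSlope at h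
  split_ifs at h with hu hw hw
  · rw [hu, hw]; ring
  · rw [Option.some_inj, div_eq_div_iff hu hw] at h
    linear_combination -h

theorem eval_eq_pow_mul_of_isHomogeneous {f : BPoly} {d : ℕ} (hf : f.IsHomogeneous d) {v : Fin 2 → ℂ}
    (hv : v 0 ≠ 0) : eval v f = v 0 ^ d * eval ![1, v 1 / v 0] f := by
  have hv' : v = v 0 • ![1, v 1 / v 0] := by
    ext i
    fin_cases i
    · simp
    · simp [mul_div_cancel₀ _ hv]
  conv_lhs => rw [hv']
  rw [eval_eq', eval_eq', Finset.mul_sum]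
  refine Finset.sum_congr rfl fun m hm => ?_
  have hdeg : m 0 + m 1 = d := by
    rw [← hf (mem_support_iff.mp hm), Finsupp.weight_apply, Finsupp.sum_fintype _ _ (by simp)]
    simp [Fin.sum_univ_two]
  rw [← hdeg]
  simp only [Fin.prod_univ_two, Pi.smul_apply, smul_eq_mul, mul_pow, pow_add]
  ring

theorem IsBinaryForm.finite_affine_zeros {f : BPoly} (hf : IsBinaryForm f) :
    {t : ℂ | eval ![1, t] f = 0}.Finite := by
  obtain ⟨hf0, d, hd⟩ := hf
  let g : Polynomial ℂ := aeval ![1, Polynomial.X] f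
  have hg : ∀ t, g.eval t = eval ![1, t] f := by
    intro t
    have : (Polynomial.aeval t) g = aeval ![1, t] f := by
      rw [← AlgHom.comp_apply]
      congr 1
      ext i
      fin_cases i <;> simp
    simpa [Polynomial.coe_aeval_eq_eval] using this
  have hg0 : g ≠ 0 := by
    intro h0
    have hXf : (X 0 : BPoly) * f = 0 := by
      refine MvPolynomial.funext fun v => ?_
      by_cases hv : v 0 = 0
      · simp [hv]
      · simp [eval_eq_pow_mul_of_isHomogeneous hd hv, ← hg, h0]
    exact (mul_ne_zero (X_ne_zero 0) hf0) hXf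
  refine (g.finite_setOfPred_isRoot hg0).subset fun t ht => ?_
  exact (hg t).trans ht

theorem IsBinaryForm.finite_projSlope_zeros {f : BPoly} (hf : IsBinaryForm f) :
    (projSlope '' {v | eval v f = 0}).Finite := by
  obtain ⟨d, hd⟩ := hf.2
  refine ((hf.finite_affine_zeros.image some).insert none).subset ?_
  rintro _ ⟨v, hv, rfl⟩
  unfold projSlope
  split_ifs with h
  · exact Set.mem_insert _ _
  · refine Set.mem_insert_of_mem _ (Set.mem_image_of_mem _ ?_)
    rw [Set.mem_ofPred_eq, eval_eq_pow_mul_of_isHomogeneous hd h] at hv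
    exact (mul_eq_zero.mp hv).resolve_left (pow_ne_zero _ h)

/-- A binary quadratic form vanishing on three pairwise independent vectors is zero. -/
theorem quadratic_coeffs_eq_zero {α β γ : ℂ} {x y : Fin 3 → ℂ}
    (hxy : ∀ i j, i ≠ j → x i * y j ≠ x j * y i)
    (h : ∀ i, α * x i ^ 2 + β * (x i * y i) + γ * y i ^ 2 = 0) :
    α = 0 ∧ β = 0 ∧ γ = 0 := by
  have hD : (x 0 * y 1 - x 1 * y 0) * (x 0 * y 2 - x 2 * y 0) * (x 1 * y 2 - x 2 * y 1) ≠ 0 :=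
    mul_ne_zero (mul_ne_zero (sub_ne_zero.mpr (hxy 0 1 (by decide)))
      (sub_ne_zero.mpr (hxy 0 2 (by decide)))) (sub_ne_zero.mpr (hxy 1 2 (by decide)))
  have h0 := h 0
  have h1 := h 1
  have h2 := h 2
  refine ⟨(mul_eq_zero.mp ?_).resolve_right hD, (mul_eq_zero.mp ?_).resolve_right hD,
    (mul_eq_zero.mp ?_).resolve_right hD⟩
  · linear_combination (x 1 * y 1 * y 2 ^ 2 - y 1 ^ 2 * x 2 * y 2) * h0
      - (x 0 * y 0 * y 2 ^ 2 - y 0 ^ 2 * x 2 * y 2) * h1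
      + (x 0 * y 0 * y 1 ^ 2 - y 0 ^ 2 * x 1 * y 1) * h2
  · linear_combination -(x 1 ^ 2 * y 2 ^ 2 - y 1 ^ 2 * x 2 ^ 2) * h0
      + (x 0 ^ 2 * y 2 ^ 2 - y 0 ^ 2 * x 2 ^ 2) * h1
      - (x 0 ^ 2 * y 1 ^ 2 - y 0 ^ 2 * x 1 ^ 2) * h2
  · linear_combination (x 1 ^ 2 * x 2 * y 2 - x 1 * y 1 * x 2 ^ 2) * h0
      - (x 0 ^ 2 * x 2 * y 2 - x 0 * y 0 * x 2 ^ 2) * h1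
      + (x 0 ^ 2 * x 1 * y 1 - x 0 * y 0 * x 1 ^ 2) * h2

/-- Two elements of `SL(2,ℂ)` acting identically on three distinct points of `ℙ¹` agree
up to sign. -/
theorem eq_or_eq_neg_of_projSlope_eq {A B : SpecialLinearGroup (Fin 2) ℂ} {P : Fin 3 → Fin 2 → ℂ}
    (hP : ∀ i j, i ≠ j → P i 0 * P j 1 ≠ P j 0 * P i 1)
    (h : ∀ i, projSlope (A.1 *ᵥ P i) = projSlope (B.1 *ᵥ P i)) : A = B ∨ A = -B := by
  have hA := A.2
  have hB := B.2
  rw [Matrix.det_fin_two] at hA hB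
  obtain ⟨h1, h2, h3⟩ := quadratic_coeffs_eq_zero
    (α := A.1 0 0 * B.1 1 0 - A.1 1 0 * B.1 0 0)
    (β := A.1 0 0 * B.1 1 1 + A.1 0 1 * B.1 1 0 - A.1 1 0 * B.1 0 1 - A.1 1 1 * B.1 0 0)
    (γ := A.1 0 1 * B.1 1 1 - A.1 1 1 * B.1 0 1) (x := fun i => P i 0) (y := fun i => P i 1) hP
    fun i => by
      have := cross_eq_of_projSlope_eq (h i)
      simp only [Matrix.mulVec, dotProduct, Fin.sum_univ_two] at this
      linear_combination this
  obtain ⟨c, hc⟩ : ∃ c, c = B.1 1 1 * A.1 0 0 - B.1 0 1 * A.1 1 0 := ⟨_, rfl⟩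
  have e00 : A.1 0 0 = c * B.1 0 0 := by
    linear_combination -A.1 0 0 * hB - B.1 0 1 * h1 - B.1 0 0 * hc
  have e10 : A.1 1 0 = c * B.1 1 0 := by
    linear_combination -A.1 1 0 * hB - B.1 1 1 * h1 - B.1 1 0 * hc
  have e01 : A.1 0 1 = c * B.1 0 1 := by
    linear_combination -A.1 0 1 * hB + B.1 0 0 * h3 - B.1 0 1 * hc - B.1 0 1 * h2
  have e11 : A.1 1 1 = c * B.1 1 1 := by
    linear_combination -A.1 1 1 * hB + B.1 1 0 * h3 - B.1 1 1 * hc - B.1 1 1 * h2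
  have hc2 : c ^ 2 = 1 := by
    rw [e00, e10, e01, e11] at hA
    linear_combination hA - c ^ 2 * hB
  rcases eq_or_eq_neg_of_sq_eq_sq c 1 (hc2.trans (one_pow 2).symm) with hc1 | hc1
  · left
    ext i j
    fin_cases i <;> fin_cases j <;> simp [e00, e01, e10, e11, hc1]
  · right
    ext i j
    fin_cases i <;> fin_cases j <;> simp [e00, e01, e10, e11, hc1]

/-- A binary form with at least three pairwise non-proportional linear factors
(i.e. at least three distinct zeros in `ℙ¹`) has finite stabilizer in `SL(2,ℂ)`. -/
theorem stab_finite_of_three_distinct_roots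
    (f : BPoly) (hbf : IsBinaryForm f)
    (a b : Fin 3 → ℂ) (hab : ∀ i, (a i, b i) ≠ (0, 0))
    (hdvd : ∀ i, (C (a i) * Px + C (b i) * Py) ∣ f)
    (hdistinct : ∀ i j, i ≠ j → a i * b j ≠ a j * b i) :
    (Stab f).Finite := by
  let P : Fin 3 → Fin 2 → ℂ := fun i => ![b i, -a i]
  have hroot : ∀ i, eval (P i) f = 0 := fun i => by
    obtain ⟨g, hg⟩ := hdvd i
    simp only [hg, map_mul, map_add, eval_C, Px, Py, eval_X, P, cons_val_zero, cons_val_one]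
    ring
  have hP : ∀ i j, i ≠ j → P i 0 * P j 1 ≠ P j 0 * P i 1 := fun i j hij h =>
    hdistinct i j hij (by simp [P] at h; linear_combination -h)
  refine Set.Finite.of_finite_fibers (fun A i => projSlope (A.1 *ᵥ P i)) ?_ ?_
  · refine (Set.Finite.pi' fun _ : Fin 3 => hbf.finite_projSlope_zeros).subset ?_
    rintro _ ⟨A, ⟨c, -, hA⟩, rfl⟩ i
    refine Set.mem_image_of_mem _ ?_
    rw [Set.mem_ofPred_eq, ← eval_matAct, hA, map_mul, hroot, mul_zero]
  · rintro _ ⟨B, -, rfl⟩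
    refine (Set.toFinite {B, -B}).subset ?_
    rintro A ⟨-, hA⟩
    exact eq_or_eq_neg_of_projSlope_eq hP fun i => congrFun hA i

end
end

section
/- Every square-free binary quartic f ∈ ℂ[x,y] is SL(2,ℂ)-equivalent up to a nonzero scalar to λ(x²+y²)² + μ(x²−y²)² for some (λ,μ) ∈ ℂ² \ {(0,0)}; that is, there exist A ∈ SL(2,ℂ), c ∈ ℂ \ {0} and (λ,μ) ≠ (0,0) with c·(f·A) = λ(x²+y²)² + μ(x²−y²)². In particular the stabilizer Stab(f) contains a subgroup conjugate in SL(2,ℂ) to the order-8 group D₂ generated by diag(i,−i) and [[0,i],[i,0]]. -/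
open MvPolynomial Matrix

noncomputable section

/-- The binary quartic with coefficients `a, b, c, d, e`. -/
def quartic (a b c d e : ℂ) : BPoly :=
  C a * Px ^ 4 + C b * (Px ^ 3 * Py) + C c * (Px ^ 2 * Py ^ 2) + C d * (Px * Py ^ 3) + C e * Py ^ 4

lemma matAct_eq_bind₁ (A : Matrix (Fin 2) (Fin 2) ℂ) :
    matAct A = bind₁ (fun i => C (A i 0) * Px + C (A i 1) * Py) := rfl

lemma matAct_map_mul (A : Matrix (Fin 2) (Fin 2) ℂ) (f g : BPoly) :
    matAct A (f * g) = matAct A f * matAct A g := by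
  simp [matAct_eq_bind₁]

lemma matAct_C (A : Matrix (Fin 2) (Fin 2) ℂ) (c : ℂ) : matAct A (C c) = C c := by
  simp [matAct_eq_bind₁]

lemma matAct_Px (A : Matrix (Fin 2) (Fin 2) ℂ) :
    matAct A Px = C (A 0 0) * Px + C (A 0 1) * Py := by
  rw [matAct_eq_bind₁, Px, bind₁_X_right]

lemma matAct_Py (A : Matrix (Fin 2) (Fin 2) ℂ) :
    matAct A Py = C (A 1 0) * Px + C (A 1 1) * Py := by
  rw [matAct_eq_bind₁, Py, bind₁_X_right]

lemma matAct_mul (A B : Matrix (Fin 2) (Fin 2) ℂ) (f : BPoly) :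
    matAct (A * B) f = matAct B (matAct A f) := by
  simp only [matAct_eq_bind₁, bind₁_bind₁]
  congr 2
  funext i
  simp only [← matAct_eq_bind₁]
  rw [matAct_eq_bind₁, map_add, map_mul, map_mul, ← matAct_eq_bind₁, matAct_C, matAct_C,
    matAct_Px, matAct_Py]
  simp only [Matrix.mul_apply, Fin.sum_univ_two, map_add, map_mul]
  ring

lemma matAct_one (f : BPoly) : matAct 1 f = f := by
  have : (fun i : Fin 2 => C ((1 : Matrix (Fin 2) (Fin 2) ℂ) i 0) * Px +
      C ((1 : Matrix (Fin 2) (Fin 2) ℂ) i 1) * Py) = (X : Fin 2 → BPoly) := by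
    funext i
    fin_cases i <;> simp [Px, Py, Matrix.one_apply]
  rw [matAct_eq_bind₁, this, bind₁_X_left]
  rfl

lemma matAct_quartic (A : Matrix (Fin 2) (Fin 2) ℂ) (a b c d e : ℂ) :
    matAct A (quartic a b c d e) =
      C a * (C (A 0 0) * Px + C (A 0 1) * Py) ^ 4 +
      C b * ((C (A 0 0) * Px + C (A 0 1) * Py) ^ 3 * (C (A 1 0) * Px + C (A 1 1) * Py)) +
      C c * ((C (A 0 0) * Px + C (A 0 1) * Py) ^ 2 * (C (A 1 0) * Px + C (A 1 1) * Py) ^ 2) +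
      C d * ((C (A 0 0) * Px + C (A 0 1) * Py) * (C (A 1 0) * Px + C (A 1 1) * Py) ^ 3) +
      C e * (C (A 1 0) * Px + C (A 1 1) * Py) ^ 4 := by
  rw [← matAct_Px, ← matAct_Py, quartic]
  conv_rhs => rw [← matAct_C A a, ← matAct_C A b, ← matAct_C A c, ← matAct_C A d, ← matAct_C A e]
  simp only [matAct_eq_bind₁, map_add, map_mul, map_pow]

/-- `GL(2,ℂ)`-equivalence of binary forms. -/
def GLEquiv (f g : BPoly) : Prop :=
  ∃ A : Matrix (Fin 2) (Fin 2) ℂ, A.det ≠ 0 ∧ matAct A f = g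

lemma GLEquiv.trans {f g h : BPoly} (hfg : GLEquiv f g) (hgh : GLEquiv g h) : GLEquiv f h := by
  obtain ⟨A, hA, rfl⟩ := hfg
  obtain ⟨B, hB, rfl⟩ := hgh
  exact ⟨A * B, by rw [Matrix.det_mul]; exact mul_ne_zero hA hB, matAct_mul A B f⟩

lemma GLEquiv.squarefree {f g : BPoly} (h : GLEquiv f g) (hf : Squarefree f) : Squarefree g := by
  obtain ⟨A, hA, rfl⟩ := h
  have hu : IsUnit A.det := isUnit_iff_ne_zero.mpr hA
  have key (u : BPoly) : matAct A (matAct A⁻¹ u) = u := by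
    rw [← matAct_mul, Matrix.nonsing_inv_mul A hu, matAct_one]
  rintro u ⟨v, hv⟩
  have h1 : matAct A⁻¹ u * matAct A⁻¹ u ∣ f := by
    refine ⟨matAct A⁻¹ v, ?_⟩
    rw [← matAct_map_mul, ← matAct_map_mul, ← hv, ← matAct_mul, Matrix.mul_nonsing_inv A hu,
      matAct_one]
  have h2 := (hf _ h1).map (bind₁ (fun i => C (A i 0) * Px + C (A i 1) * Py))
  rw [← matAct_eq_bind₁, key] at h2
  exact h2

lemma exists_eq_quartic {f : BPoly} (hf : f.IsHomogeneous 4) :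
    ∃ a b c d e, f = quartic a b c d e := by
  obtain ⟨g, hg⟩ : ∃ g : ℕ → ℂ, f = ∑ k ∈ Finset.range 5,
      monomial (Finsupp.single 0 k + Finsupp.single 1 (4 - k)) (g k) := by
    refine ⟨fun k => coeff (Finsupp.single 0 k + Finsupp.single 1 (4 - k)) f, ?_⟩
    ext m
    have hm : m = Finsupp.single 0 (m 0) + Finsupp.single 1 (m 1) := by
      ext i; fin_cases i <;> simp
    rw [coeff_sum]
    simp only [coeff_monomial]
    by_cases hd : m 0 + m 1 = 4
    · rw [Finset.sum_eq_single (m 0)]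
      · have h1 : 4 - m 0 = m 1 := by omega
        rw [h1, ← hm, if_pos rfl]
      · intro k _ hk
        refine if_neg fun h => hk ?_
        simpa using DFunLike.congr_fun h 0
      · intro h
        simp at h
        omega
    · rw [Finset.sum_eq_zero]
      · by_contra h0
        have := hf h0
        rw [hm] at this
        simp [Finsupp.weight_apply, Finsupp.sum_fintype] at this
        exact hd this
      · intro k hk
        refine if_neg fun h => hd ?_
        rw [← h]
        simp at hk ⊢
        omega
  refine ⟨g 4, g 3, g 2, g 1, g 0, hg.trans ?_⟩
  have hmon (i j : ℕ) (z : ℂ) : (monomial (Finsupp.single 0 i + Finsupp.single 1 j) z : BPoly) =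
      C z * Px ^ i * Py ^ j := by
    rw [monomial_add_single, ← C_mul_X_pow_eq_monomial, Px, Py]
  simp only [Finset.sum_range_succ, Finset.sum_range_zero, hmon, quartic]
  ring

lemma matAct_quartic_of (p q r s a b c d e a' b' c' d' e' : ℂ)
    (ha : a' = a * p ^ 4 + b * p ^ 3 * r + c * p ^ 2 * r ^ 2 + d * p * r ^ 3 + e * r ^ 4)
    (hb : b' = 4 * a * p ^ 3 * q + b * (3 * p ^ 2 * q * r + p ^ 3 * s) +
      c * (2 * p * q * r ^ 2 + 2 * p ^ 2 * r * s) + d * (q * r ^ 3 + 3 * p * r ^ 2 * s) +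
      4 * e * r ^ 3 * s)
    (hc : c' = 6 * a * p ^ 2 * q ^ 2 + b * (3 * p * q ^ 2 * r + 3 * p ^ 2 * q * s) +
      c * (q ^ 2 * r ^ 2 + 4 * p * q * r * s + p ^ 2 * s ^ 2) +
      d * (3 * q * r ^ 2 * s + 3 * p * r * s ^ 2) + 6 * e * r ^ 2 * s ^ 2)
    (hd : d' = 4 * a * p * q ^ 3 + b * (q ^ 3 * r + 3 * p * q ^ 2 * s) +
      c * (2 * q ^ 2 * r * s + 2 * p * q * s ^ 2) + d * (3 * q * r * s ^ 2 + p * s ^ 3) +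
      4 * e * r * s ^ 3)
    (he : e' = a * q ^ 4 + b * q ^ 3 * s + c * q ^ 2 * s ^ 2 + d * q * s ^ 3 + e * s ^ 4) :
    matAct !![p, q; r, s] (quartic a b c d e) = quartic a' b' c' d' e' := by
  have h (n : ℕ) [n.AtLeastTwo] : (C (OfNat.ofNat n : ℂ) : BPoly) = OfNat.ofNat n := map_ofNat C n
  subst ha hb hc hd he
  rw [matAct_quartic, quartic]
  simp only [Matrix.of_apply, Matrix.cons_val', Matrix.cons_val_zero, Matrix.cons_val_one,
    Matrix.cons_val_fin_one, map_add, map_mul, map_pow, h]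
  ring

lemma exists_quartic_root {a : ℂ} (ha : a ≠ 0) (b c d e : ℂ) :
    ∃ t : ℂ, a * t ^ 4 + b * t ^ 3 + c * t ^ 2 + d * t + e = 0 := by
  have hdeg : (Polynomial.C a * Polynomial.X ^ 4 + Polynomial.C b * Polynomial.X ^ 3 +
      Polynomial.C c * Polynomial.X ^ 2 + Polynomial.C d * Polynomial.X + Polynomial.C e : Polynomial ℂ).degree = 4 := by
    compute_degree!
  obtain ⟨t, ht⟩ := IsAlgClosed.exists_root _ (by rw [hdeg]; decide)
  exact ⟨t, by simpa using ht⟩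

lemma exists_cubic_root {a : ℂ} (ha : a ≠ 0) (b c d : ℂ) :
    ∃ t : ℂ, a * t ^ 3 + b * t ^ 2 + c * t + d = 0 := by
  have hdeg : (Polynomial.C a * Polynomial.X ^ 3 + Polynomial.C b * Polynomial.X ^ 2 +
      Polynomial.C c * Polynomial.X + Polynomial.C d : Polynomial ℂ).degree = 3 := by
    compute_degree!
  obtain ⟨t, ht⟩ := IsAlgClosed.exists_root _ (by rw [hdeg]; decide)
  exact ⟨t, by simpa using ht⟩

lemma not_squarefree_quartic_left (a b c : ℂ) : ¬ Squarefree (quartic a b c 0 0) := fun h =>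
  (X_prime (R := ℂ) (i := (0 : Fin 2))).not_isUnit
    (h Px ⟨C a * Px ^ 2 + C b * (Px * Py) + C c * Py ^ 2, by
      simp only [quartic, map_zero]; ring⟩)

lemma not_squarefree_quartic_right (c d e : ℂ) : ¬ Squarefree (quartic 0 0 c d e) := fun h =>
  (X_prime (R := ℂ) (i := (1 : Fin 2))).not_isUnit
    (h Py ⟨C c * Px ^ 2 + C d * (Px * Py) + C e * Py ^ 2, by
      simp only [quartic, map_zero]; ring⟩)

lemma GLEquiv.of_quartic (p q r s a b c d e a' b' c' d' e' : ℂ) (hdet : p * s - q * r ≠ 0)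
    (h : matAct !![p, q; r, s] (quartic a b c d e) = quartic a' b' c' d' e') :
    GLEquiv (quartic a b c d e) (quartic a' b' c' d' e') :=
  ⟨!![p, q; r, s], by rwa [Matrix.det_fin_two_of], h⟩

lemma exists_glEquiv_leading_zero (a b c d e : ℂ) :
    ∃ b' c' d' e', GLEquiv (quartic a b c d e) (quartic 0 b' c' d' e') := by
  by_cases ha : a = 0
  · exact ⟨b, c, d, e, 1, by simp, by rw [matAct_one, ha]⟩
  obtain ⟨t, ht⟩ := exists_quartic_root ha b c d e
  exact ⟨_, _, _, _, .of_quartic t 1 1 0 _ _ _ _ _ _ _ _ _ _ (by simp)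
    (matAct_quartic_of _ _ _ _ _ _ _ _ _ _ _ _ _ _ (by linear_combination -ht) rfl rfl rfl rfl)⟩

lemma exists_glEquiv_ends_zero {b : ℂ} (hb : b ≠ 0) (c d e : ℂ) :
    ∃ c' d', GLEquiv (quartic 0 b c d e) (quartic 0 b c' d' 0) := by
  obtain ⟨t, ht⟩ := exists_cubic_root hb c d e
  exact ⟨_, _, .of_quartic 1 t 0 1 _ _ _ _ _ _ _ _ _ _ (by simp)
    (matAct_quartic_of _ _ _ _ _ _ _ _ _ _ _ _ _ _ (by ring) (by ring) rfl rfl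
      (by linear_combination -ht))⟩

lemma exists_glEquiv_symmetric {b d : ℂ} (hb : b ≠ 0) (c : ℂ) (hd : d ≠ 0) :
    ∃ m n, GLEquiv (quartic 0 b c d 0) (quartic 0 m n m 0) := by
  obtain ⟨t, ht⟩ := IsAlgClosed.exists_pow_nat_eq (d / b) two_pos
  have htb : b * t ^ 2 = d := by rw [ht]; field_simp
  have ht0 : t ≠ 0 := by
    rintro rfl
    exact hd (by rw [← htb]; ring)
  exact ⟨d * t, c * t ^ 2, .of_quartic t 0 0 1 _ _ _ _ _ _ _ _ _ _ (by simpa)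
    (matAct_quartic_of _ _ _ _ _ _ _ _ _ _ _ _ _ _ (by ring) (by linear_combination -t * htb)
      (by ring) (by ring) (by ring))⟩

lemma glEquiv_even (m n : ℂ) :
    GLEquiv (quartic 0 m n m 0) (quartic (2 * m + n) 0 (-2 * n) 0 (n - 2 * m)) :=
  .of_quartic 1 1 1 (-1) _ _ _ _ _ _ _ _ _ _ (by norm_num)
    (matAct_quartic_of _ _ _ _ _ _ _ _ _ _ _ _ _ _ (by ring) (by ring) (by ring) (by ring)
      (by ring))

lemma exists_glEquiv_palindromic {a e : ℂ} (ha : a ≠ 0) (c : ℂ) (he : e ≠ 0) :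
    ∃ c', GLEquiv (quartic a 0 c 0 e) (quartic e 0 c' 0 e) := by
  obtain ⟨t, ht⟩ := IsAlgClosed.exists_pow_nat_eq (e / a) four_pos
  have hta : a * t ^ 4 = e := by rw [ht]; field_simp
  have ht0 : t ≠ 0 := by
    rintro rfl
    exact he (by rw [← hta]; ring)
  exact ⟨c * t ^ 2, .of_quartic t 0 0 1 _ _ _ _ _ _ _ _ _ _ (by simpa)
    (matAct_quartic_of _ _ _ _ _ _ _ _ _ _ _ _ _ _ (by linear_combination -hta) (by ring)
      (by ring) (by ring) (by ring))⟩

lemma exists_glEquiv_normalForm {f : BPoly} (hf4 : f.IsHomogeneous 4) (hsf : Squarefree f) :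
    ∃ a c, a ≠ 0 ∧ GLEquiv f (quartic a 0 c 0 a) := by
  obtain ⟨a, b, c, d, e, rfl⟩ := exists_eq_quartic hf4
  obtain ⟨b₁, c₁, d₁, e₁, h₁⟩ := exists_glEquiv_leading_zero a b c d e
  have hb₁ : b₁ ≠ 0 := by
    rintro rfl
    exact not_squarefree_quartic_right _ _ _ (h₁.squarefree hsf)
  obtain ⟨c₂, d₂, h₂⟩ := exists_glEquiv_ends_zero hb₁ c₁ d₁ e₁
  replace h₂ := h₁.trans h₂
  have hd₂ : d₂ ≠ 0 := by
    rintro rfl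
    exact not_squarefree_quartic_left _ _ _ (h₂.squarefree hsf)
  obtain ⟨m, n, h₃⟩ := exists_glEquiv_symmetric hb₁ c₂ hd₂
  have h₄ := (h₂.trans h₃).trans (glEquiv_even m n)
  have hl : 2 * m + n ≠ 0 := by
    intro h
    rw [h] at h₄
    exact not_squarefree_quartic_right _ _ _ (h₄.squarefree hsf)
  have hr : n - 2 * m ≠ 0 := by
    intro h
    rw [h] at h₄
    exact not_squarefree_quartic_left _ _ _ (h₄.squarefree hsf)
  obtain ⟨c', h₅⟩ := exists_glEquiv_palindromic hl (-2 * n) hr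
  exact ⟨_, c', hr, h₄.trans h₅⟩

lemma matAct_smul {n : ℕ} (t : ℂ) (A : Matrix (Fin 2) (Fin 2) ℂ) {f : BPoly}
    (hf : f.IsHomogeneous n) : matAct (t • A) f = C (t ^ n) * matAct A f := by
  have key (i : Fin 2) : C ((t • A) i 0) * Px + C ((t • A) i 1) * Py =
      C t * (C (A i 0) * Px + C (A i 1) * Py) := by
    simp only [Matrix.smul_apply, smul_eq_mul, map_mul]
    ring
  simp only [matAct_eq_bind₁, key]
  change eval₂ _ _ f = _ * eval₂ _ _ f
  rw [eval₂_eq, eval₂_eq, Finset.mul_sum]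
  refine Finset.sum_congr rfl fun m hm => ?_
  have hd : ∑ i ∈ m.support, m i = n := by
    simpa [Finsupp.weight_apply, Finsupp.sum] using hf (mem_support_iff.mp hm)
  simp only [mul_pow, Finset.prod_mul_distrib, Finset.prod_pow_eq_pow_sum, hd, map_pow]
  ring

lemma exists_specialLinearGroup_matAct {n : ℕ} {f g : BPoly} (hf : f.IsHomogeneous n)
    (h : GLEquiv f g) : ∃ A : SpecialLinearGroup (Fin 2) ℂ, ∃ c : ℂ, c ≠ 0 ∧
      C c * matAct (A : Matrix (Fin 2) (Fin 2) ℂ) f = g := by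
  obtain ⟨A, hA, rfl⟩ := h
  obtain ⟨t, ht⟩ := IsAlgClosed.exists_pow_nat_eq A.det two_pos
  have ht0 : t ≠ 0 := by
    rintro rfl
    exact hA (by rw [← ht]; ring)
  refine ⟨⟨t⁻¹ • A, ?_⟩, t ^ n, pow_ne_zero _ ht0, ?_⟩
  · rw [Matrix.det_smul, ← ht, Fintype.card_fin]
    field_simp
  · rw [← matAct_smul _ _ hf, smul_inv_smul₀ ht0]

lemma quartic_palindromic_eq (a c : ℂ) :
    quartic a 0 c 0 a = C (a / 2 + c / 4) * (Px ^ 2 + Py ^ 2) ^ 2 +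
      C (a / 2 - c / 4) * (Px ^ 2 - Py ^ 2) ^ 2 := by
  have ha : a = (a / 2 + c / 4) + (a / 2 - c / 4) := by ring
  have hc : c = 2 * (a / 2 + c / 4) - 2 * (a / 2 - c / 4) := by ring
  generalize a / 2 + c / 4 = l, a / 2 - c / 4 = m at *
  subst hc ha
  simp only [quartic, map_add, map_sub, map_mul, map_zero, map_ofNat]
  ring

lemma matAct_eq_of_mem_closure {s : Set (SpecialLinearGroup (Fin 2) ℂ)} {g : BPoly}
    (hs : ∀ A ∈ s, matAct (A : Matrix (Fin 2) (Fin 2) ℂ) g = g)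
    {A : SpecialLinearGroup (Fin 2) ℂ} (hA : A ∈ Subgroup.closure s) :
    matAct (A : Matrix (Fin 2) (Fin 2) ℂ) g = g := by
  induction hA using Subgroup.closure_induction with
  | mem A hA => exact hs A hA
  | one => rw [Matrix.SpecialLinearGroup.coe_one, matAct_one]
  | mul A B _ _ hA hB => rw [Matrix.SpecialLinearGroup.coe_mul, matAct_mul, hA, hB]
  | inv A _ hA =>
    conv_lhs => rw [← hA]
    rw [← matAct_mul, ← Matrix.SpecialLinearGroup.coe_mul, mul_inv_cancel,
      Matrix.SpecialLinearGroup.coe_one,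
      matAct_one]

lemma conj_mem_stab {f g : BPoly} {A B : SpecialLinearGroup (Fin 2) ℂ} {c : ℂ} (hc : c ≠ 0)
    (hB : C c * matAct (B : Matrix (Fin 2) (Fin 2) ℂ) f = g)
    (hA : matAct (A : Matrix (Fin 2) (Fin 2) ℂ) g = g) : B * A * B⁻¹ ∈ Stab f := by
  have hA' : matAct (A : Matrix (Fin 2) (Fin 2) ℂ) (matAct (B : Matrix (Fin 2) (Fin 2) ℂ) f) =
      matAct (B : Matrix (Fin 2) (Fin 2) ℂ) f := by
    rw [← hB, matAct_map_mul, matAct_C] at hA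
    exact mul_left_cancel₀ (by simpa using hc) hA
  refine ⟨1, one_ne_zero, ?_⟩
  rw [Matrix.SpecialLinearGroup.coe_mul, Matrix.SpecialLinearGroup.coe_mul, matAct_mul, matAct_mul,
    hA',
    ← matAct_mul, ← Matrix.SpecialLinearGroup.coe_mul, mul_inv_cancel,
      Matrix.SpecialLinearGroup.coe_one,
    matAct_one, C_1, one_mul]

lemma coe_diag_pow {D : SpecialLinearGroup (Fin 2) ℂ}
    (hD : (D : Matrix (Fin 2) (Fin 2) ℂ) = !![Complex.I, 0; 0, -Complex.I]) (n : ℕ) :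
    ((D ^ n : SpecialLinearGroup (Fin 2) ℂ) : Matrix (Fin 2) (Fin 2) ℂ) =
      !![Complex.I ^ n, 0; 0, (-Complex.I) ^ n] := by
  induction n with
  | zero => simp [Matrix.one_fin_two]
  | succ n ih => simp [pow_succ, ih, hD]

lemma pow_mul_pow_injective {D S : SpecialLinearGroup (Fin 2) ℂ}
    (hD : (D : Matrix (Fin 2) (Fin 2) ℂ) = !![Complex.I, 0; 0, -Complex.I])
    (hS : (S : Matrix (Fin 2) (Fin 2) ℂ) = !![0, Complex.I; Complex.I, 0]) :
    Function.Injective fun p : Fin 4 × Fin 2 => D ^ (p.1 : ℕ) * S ^ (p.2 : ℕ) := by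
  have hI : Function.Injective fun i : Fin 4 => Complex.I ^ (i : ℕ) := by
    intro i j h
    fin_cases i <;> fin_cases j <;> simp [Complex.ext_iff, pow_succ] at h ⊢ <;> norm_num at h
  rintro ⟨i, k⟩ ⟨j, l⟩ h
  have h' : (D ^ (i : ℕ) : SpecialLinearGroup (Fin 2) ℂ).1 *
      (S ^ (k : ℕ) : SpecialLinearGroup (Fin 2) ℂ).1 =
      (D ^ (j : ℕ) : SpecialLinearGroup (Fin 2) ℂ).1 *
      (S ^ (l : ℕ) : SpecialLinearGroup (Fin 2) ℂ).1 := congrArg Subtype.val h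
  rw [coe_diag_pow hD, coe_diag_pow hD] at h'
  have h00 := congrFun₂ h' 0 0
  have h01 := congrFun₂ h' 0 1
  have := @hI i j
  fin_cases k <;> fin_cases l <;> simp [hS] at h00 h01 this ⊢ <;> exact this (by assumption)

lemma mem_closure_iff_exists_pow_mul_pow {D S : SpecialLinearGroup (Fin 2) ℂ}
    (hD : (D : Matrix (Fin 2) (Fin 2) ℂ) = !![Complex.I, 0; 0, -Complex.I])
    (hS : (S : Matrix (Fin 2) (Fin 2) ℂ) = !![0, Complex.I; Complex.I, 0])
    {A : SpecialLinearGroup (Fin 2) ℂ} :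
    A ∈ Subgroup.closure {D, S} ↔
      A ∈ Set.range fun p : Fin 4 × Fin 2 => D ^ (p.1 : ℕ) * S ^ (p.2 : ℕ) := by
  have hD4 : D ^ 4 = 1 := by
    ext i j
    rw [coe_diag_pow hD]
    fin_cases i <;> fin_cases j <;> simp [Even.neg_pow (by decide : Even 4)]
  have hS2 : S ^ 2 = D ^ 2 := by
    ext i j
    rw [coe_diag_pow hD]
    fin_cases i <;> fin_cases j <;> simp [pow_two, hS]
  have hSD : SemiconjBy S D (D ^ 3) := by
    ext i j
    rw [Matrix.SpecialLinearGroup.coe_mul, Matrix.SpecialLinearGroup.coe_mul, coe_diag_pow hD, hS,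
      hD]
    fin_cases i <;> fin_cases j <;> simp [pow_succ]
  constructor
  · intro hA
    obtain ⟨n, k, rfl⟩ : ∃ n k : ℕ, D ^ n * S ^ k = A := by
      have hmulD (B) : (∃ n k : ℕ, D ^ n * S ^ k = B) → ∃ n k : ℕ, D ^ n * S ^ k = D * B := by
        rintro ⟨n, k, rfl⟩
        exact ⟨n + 1, k, by rw [pow_succ', mul_assoc]⟩
      have hmulS (B) : (∃ n k : ℕ, D ^ n * S ^ k = B) → ∃ n k : ℕ, D ^ n * S ^ k = S * B := by
        rintro ⟨n, k, rfl⟩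
        refine ⟨3 * n, k + 1, ?_⟩
        rw [pow_succ', ← mul_assoc, ← mul_assoc, (hSD.pow_right n).eq, pow_mul]
      have hDinv : D⁻¹ = D * D * D := by
        rw [inv_eq_iff_mul_eq_one, ← hD4]
        simp only [pow_succ, pow_zero, one_mul, mul_assoc]
      have hSinv : S⁻¹ = S * S * S := by
        rw [inv_eq_iff_mul_eq_one, ← hD4, pow_mul D 2 2, ← hS2]
        simp only [pow_succ, pow_zero, one_mul, mul_assoc]
      induction hA using Subgroup.closure_induction_left with
      | one => exact ⟨0, 0, by simp⟩
      | mul_left x hx y _ hy =>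
        rcases hx with rfl | rfl
        · exact hmulD _ hy
        · exact hmulS _ hy
      | inv_mul_cancel x hx y _ hy =>
        rcases hx with rfl | rfl
        · rw [hDinv, mul_assoc, mul_assoc]
          exact hmulD _ (hmulD _ (hmulD _ hy))
        · rw [hSinv, mul_assoc, mul_assoc]
          exact hmulS _ (hmulS _ (hmulS _ hy))
    refine ⟨(⟨(n + 2 * (k / 2)) % 4, Nat.mod_lt _ (by norm_num)⟩, ⟨k % 2, Nat.mod_lt _ two_pos⟩), ?_⟩
    conv_rhs => rw [← Nat.div_add_mod k 2, pow_add, pow_mul, hS2, ← pow_mul, ← mul_assoc, ← pow_add,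
      pow_eq_pow_mod _ hD4]
  · rintro ⟨p, rfl⟩
    exact mul_mem (pow_mem (Subgroup.subset_closure (by simp)) _)
      (pow_mem (Subgroup.subset_closure (by simp)) _)

lemma card_closure_eq_eight {D S : SpecialLinearGroup (Fin 2) ℂ}
    (hD : (D : Matrix (Fin 2) (Fin 2) ℂ) = !![Complex.I, 0; 0, -Complex.I])
    (hS : (S : Matrix (Fin 2) (Fin 2) ℂ) = !![0, Complex.I; Complex.I, 0]) :
    Nat.card (Subgroup.closure {D, S} : Subgroup (SpecialLinearGroup (Fin 2) ℂ)) = 8 := by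
  rw [Nat.card_congr (Equiv.subtypeEquivRight fun A => mem_closure_iff_exists_pow_mul_pow hD hS),
    Nat.card_congr (Equiv.ofInjective _ (pow_mul_pow_injective hD hS)).symm]
  simp

/-- Every square-free binary quartic is `SL(2,ℂ)`-equivalent up to a nonzero
scalar to `λ(x²+y²)² + μ(x²-y²)²` for some `(λ,μ) ≠ (0,0)`; in particular its
stabilizer contains a subgroup conjugate in `SL(2,ℂ)` to the order-8 group `D₂`
generated by `diag(i,-i)` and `[[0,i],[i,0]]`. -/
theorem squarefree_quartic_normal_form
    (f : BPoly) (hf0 : f ≠ 0) (hf4 : f.IsHomogeneous 4) (hsf : Squarefree f)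
    (D S : SpecialLinearGroup (Fin 2) ℂ)
    (hD : (D : Matrix (Fin 2) (Fin 2) ℂ) = !![Complex.I, 0; 0, -Complex.I])
    (hS : (S : Matrix (Fin 2) (Fin 2) ℂ) = !![0, Complex.I; Complex.I, 0]) :
    (∃ A : SpecialLinearGroup (Fin 2) ℂ, ∃ c : ℂ, c ≠ 0 ∧
      ∃ lam mu : ℂ, (lam, mu) ≠ (0, 0) ∧
        C c * matAct (A : Matrix (Fin 2) (Fin 2) ℂ) f =
          C lam * (Px ^ 2 + Py ^ 2) ^ 2 + C mu * (Px ^ 2 - Py ^ 2) ^ 2) ∧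
    Nat.card (Subgroup.closure {D, S} : Subgroup (SpecialLinearGroup (Fin 2) ℂ)) = 8 ∧
    ∃ B : SpecialLinearGroup (Fin 2) ℂ,
      ∀ A ∈ Subgroup.closure {D, S}, B * A * B⁻¹ ∈ Stab f := by
  obtain ⟨a, c, ha, h⟩ := exists_glEquiv_normalForm hf4 hsf
  obtain ⟨A, k, hk, hA⟩ := exists_specialLinearGroup_matAct hf4 h
  refine ⟨⟨A, k, hk, a / 2 + c / 4, a / 2 - c / 4, ?_, hA.trans (quartic_palindromic_eq a c)⟩,
    card_closure_eq_eight hD hS, A, fun B hB => conj_mem_stab hk hA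
      (matAct_eq_of_mem_closure ?_ hB)⟩
  · intro h0
    rw [Prod.mk.injEq] at h0
    exact ha (by linear_combination h0.1 + h0.2)
  · have hI : Complex.I ^ 4 = 1 := Complex.I_pow_four
    rintro _ (rfl | rfl)
    · rw [hD]
      exact matAct_quartic_of _ _ _ _ _ _ _ _ _ _ _ _ _ _ (by linear_combination -a * hI)
        (by ring) (by linear_combination -c * hI) (by ring) (by linear_combination -a * hI)
    · rw [hS]
      exact matAct_quartic_of _ _ _ _ _ _ _ _ _ _ _ _ _ _ (by linear_combination -a * hI)
        (by ring) (by linear_combination -c * hI) (by ring) (by linear_combination -a * hI)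

end
end

section
/- Let f ∈ ℂ[x,y] be a binary quintic all of whose linear factors occur with multiplicity at most 2 (a stable quintic). If the stabilizer Stab(f) ⊂ SL(2,ℂ) strictly contains {I, −I}, then f is SL(2,ℂ)-equivalent up to a nonzero scalar to one of the following forms: (I) x(x²+y²)(λx²+μy²) for some (λ,μ) ∈ ℂ² \ {(0,0)}; (II) x²(x³+y³); (III) x(x⁴+y⁴); (IV) xy(x³+y³); (V) x⁵+y⁵. -/
open MvPolynomial Matrix

noncomputable section

/-- The map `matAct A` bundled as an algebra homomorphism. -/
def matActHom (A : Matrix (Fin 2) (Fin 2) ℂ) : BPoly →ₐ[ℂ] BPoly :=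
  bind₁ (fun i => C (A i 0) * Px + C (A i 1) * Py)

lemma matAct_eq_matActHom (A : Matrix (Fin 2) (Fin 2) ℂ) (f : BPoly) :
    matAct A f = matActHom A f := rfl

lemma matActHom_C (A : Matrix (Fin 2) (Fin 2) ℂ) (c : ℂ) : matActHom A (C c) = C c :=
  bind₁_C_right _ _

lemma matActHom_Px (A : Matrix (Fin 2) (Fin 2) ℂ) :
    matActHom A Px = C (A 0 0) * Px + C (A 0 1) * Py :=
  bind₁_X_right _ _

lemma matActHom_Py (A : Matrix (Fin 2) (Fin 2) ℂ) :
    matActHom A Py = C (A 1 0) * Px + C (A 1 1) * Py :=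
  bind₁_X_right _ _

lemma EquivForm.of_matAct {f g : BPoly} {P : Matrix (Fin 2) (Fin 2) ℂ} (hP : P.det = 1)
    (h : EquivForm (matAct P f) g) : EquivForm f g := by
  obtain ⟨A, c, hc, hA⟩ := h
  refine ⟨⟨P, hP⟩ * A, c, hc, ?_⟩
  rw [← hA, ← matAct_mul]
  rfl

/-- No linear form divides `f` three times. -/
def NoTripleFactor (f : BPoly) : Prop :=
  ∀ a b : ℂ, (a, b) ≠ (0, 0) → ¬((C a * Px + C b * Py) ^ 3 ∣ f)

lemma NoTripleFactor.matAct {f : BPoly} (hf : NoTripleFactor f)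
    {P : Matrix (Fin 2) (Fin 2) ℂ} (hP : P.det = 1) : NoTripleFactor (matAct P f) := by
  intro a b hab hdvd
  set Q := P.adjugate with hQ
  have h := map_dvd (matActHom Q) hdvd
  rw [← matAct_eq_matActHom _ (_root_.matAct _ f), ← matAct_mul, hQ, P.mul_adjugate, hP,
    one_smul, matAct_one, map_pow, ← hQ] at h
  have hdet : Q 0 0 * Q 1 1 - Q 0 1 * Q 1 0 = 1 := by
    rw [← Matrix.det_fin_two, hQ, Matrix.det_adjugate, hP, one_pow]
  have hL : matActHom Q (C a * Px + C b * Py) =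
      C (a * Q 0 0 + b * Q 1 0) * Px + C (a * Q 0 1 + b * Q 1 1) * Py := by
    simp only [matActHom_Px, map_add, map_mul, matActHom_C, matActHom_Py]
    ring
  rw [hL] at h
  refine hf _ _ (fun h0 => hab ?_) h
  simp only [Prod.mk.injEq] at h0 ⊢
  obtain ⟨h1, h2⟩ := h0
  constructor
  · linear_combination Q 1 1 * h1 - Q 1 0 * h2 - a * hdet
  · linear_combination Q 0 0 * h2 - Q 0 1 * h1 - b * hdet

lemma SemiInv.conj {f : BPoly} {A P T : Matrix (Fin 2) (Fin 2) ℂ}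
    (h : SemiInv A f) (hT : P * T = A * P) : SemiInv T (matAct P f) := by
  obtain ⟨c, hc, hA⟩ := h
  refine ⟨c, hc, ?_⟩
  rw [← matAct_mul, hT, matAct_mul, hA, matAct_eq_matActHom, map_mul, matActHom_C,
    ← matAct_eq_matActHom]

/-- The binary quintic with prescribed coefficients. -/
def quintic (a : Fin 6 → ℂ) : BPoly :=
  C (a 0) * Py ^ 5 + C (a 1) * (Px * Py ^ 4) + C (a 2) * (Px ^ 2 * Py ^ 3) +
    C (a 3) * (Px ^ 3 * Py ^ 2) + C (a 4) * (Px ^ 4 * Py) + C (a 5) * Px ^ 5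

lemma exists_eq_quintic {f : BPoly} (hf : f.IsHomogeneous 5) : ∃ a, f = quintic a := by
  rw [f.as_sum]
  refine Finset.sum_induction _ (fun g => ∃ a, g = quintic a) ?_ ?_ ?_
  · rintro _ _ ⟨a, rfl⟩ ⟨b, rfl⟩
    refine ⟨a + b, ?_⟩
    simp only [quintic, Pi.add_apply, map_add]
    ring
  · exact ⟨0, by simp [quintic]⟩
  · intro v hv
    have hdeg : v 0 + v 1 = 5 := by
      have := hf (mem_support_iff.mp hv)
      simpa [Finsupp.weight_apply, Finsupp.sum_fintype] using this
    have hmon : monomial v (coeff v f) = C (coeff v f) * (Px ^ v 0 * Py ^ v 1) := by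
      rw [monomial_eq, Finsupp.prod_fintype _ _ (by simp), Fin.prod_univ_two]
      rfl
    rw [hmon]
    obtain ⟨i, hi⟩ : ∃ i : Fin 6, (i : ℕ) = v 0 := ⟨⟨v 0, by omega⟩, rfl⟩
    have h1 : v 1 = 5 - i := by omega
    rw [h1, ← hi]
    refine ⟨Pi.single i (coeff v f), ?_⟩
    fin_cases i <;> simp [quintic]

lemma quintic_injective : Function.Injective quintic := by
  intro a b h
  have key : ∀ x : ℂ, a 0 + a 1 * x + a 2 * x ^ 2 + a 3 * x ^ 3 + a 4 * x ^ 4 + a 5 * x ^ 5 =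
      b 0 + b 1 * x + b 2 * x ^ 2 + b 3 * x ^ 3 + b 4 * x ^ 4 + b 5 * x ^ 5 := by
    intro x
    have := congrArg (eval ![x, 1]) h
    simpa [quintic, Px, Py] using this
  have h0 := key 0
  have h1 := key 1
  have h2 := key (-1)
  have h3 := key 2
  have h4 := key (-2)
  have h5 := key 3
  funext i
  fin_cases i <;> simp only [Fin.zero_eta, Fin.mk_one, Fin.reduceFinMk] <;> grind

/-- `f` is equivalent to one of the normal forms of quintics with extra symmetries. -/
def HasNormalForm (f : BPoly) : Prop :=
  (∃ lam mu : ℂ, (lam, mu) ≠ (0, 0) ∧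
    EquivForm f (Px * (Px ^ 2 + Py ^ 2) * (C lam * Px ^ 2 + C mu * Py ^ 2))) ∨
  EquivForm f (Px ^ 2 * (Px ^ 3 + Py ^ 3)) ∨
  EquivForm f (Px * (Px ^ 4 + Py ^ 4)) ∨
  EquivForm f (Px * Py * (Px ^ 3 + Py ^ 3)) ∨
  EquivForm f (Px ^ 5 + Py ^ 5)

lemma HasNormalForm.of_matAct {f : BPoly} {P : Matrix (Fin 2) (Fin 2) ℂ} (hP : P.det = 1)
    (h : HasNormalForm (matAct P f)) : HasNormalForm f := by
  rcases h with ⟨l, m, hlm, h⟩ | h | h | h | h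
  · exact Or.inl ⟨l, m, hlm, h.of_matAct hP⟩
  · exact Or.inr (Or.inl (h.of_matAct hP))
  · exact Or.inr (Or.inr (Or.inl (h.of_matAct hP)))
  · exact Or.inr (Or.inr (Or.inr (Or.inl (h.of_matAct hP))))
  · exact Or.inr (Or.inr (Or.inr (Or.inr (h.of_matAct hP))))

lemma matAct_upper_quintic (α b δ : ℂ) (a : Fin 6 → ℂ) :
    matAct !![α, b; 0, δ] (quintic a) = quintic
      ![a 0 * δ ^ 5 + a 1 * b * δ ^ 4 + a 2 * b ^ 2 * δ ^ 3 + a 3 * b ^ 3 * δ ^ 2 +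
          a 4 * b ^ 4 * δ + a 5 * b ^ 5,
        a 1 * α * δ ^ 4 + 2 * a 2 * α * b * δ ^ 3 + 3 * a 3 * α * b ^ 2 * δ ^ 2 +
          4 * a 4 * α * b ^ 3 * δ + 5 * a 5 * α * b ^ 4,
        a 2 * α ^ 2 * δ ^ 3 + 3 * a 3 * α ^ 2 * b * δ ^ 2 + 6 * a 4 * α ^ 2 * b ^ 2 * δ +
          10 * a 5 * α ^ 2 * b ^ 3,
        a 3 * α ^ 3 * δ ^ 2 + 4 * a 4 * α ^ 3 * b * δ + 10 * a 5 * α ^ 3 * b ^ 2,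
        a 4 * α ^ 4 * δ + 5 * a 5 * α ^ 4 * b,
        a 5 * α ^ 5] := by
  refine MvPolynomial.funext fun v => ?_
  simp [matAct_eq_matActHom, quintic, matActHom_Px, matActHom_Py]
  ring

lemma matAct_diag_quintic (α δ : ℂ) (a : Fin 6 → ℂ) :
    matAct !![α, 0; 0, δ] (quintic a) = quintic
      ![a 0 * δ ^ 5, a 1 * α * δ ^ 4, a 2 * α ^ 2 * δ ^ 3, a 3 * α ^ 3 * δ ^ 2,
        a 4 * α ^ 4 * δ, a 5 * α ^ 5] := by
  simp [matAct_upper_quintic]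

lemma matAct_swap_quintic (a : Fin 6 → ℂ) :
    matAct !![0, 1; -1, 0] (quintic a) = quintic ![a 5, -a 4, a 3, -a 2, a 1, -a 0] := by
  refine MvPolynomial.funext fun v => ?_
  simp [matAct_eq_matActHom, quintic, matActHom_Px, matActHom_Py]
  ring

lemma C_mul_quintic (c : ℂ) (a : Fin 6 → ℂ) : C c * quintic a = quintic (fun i => c * a i) := by
  simp only [quintic, map_mul]
  ring

lemma HasNormalForm.of_swap {a : Fin 6 → ℂ}
    (h : HasNormalForm (quintic ![a 5, -a 4, a 3, -a 2, a 1, -a 0])) :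
    HasNormalForm (quintic a) := by
  rw [← matAct_swap_quintic] at h
  exact HasNormalForm.of_matAct (by simp [Matrix.det_fin_two_of]) h

lemma EquivForm.of_scaling {a : Fin 6 → ℂ} {g : BPoly} {t c : ℂ} (ht : t ≠ 0) (hc : c ≠ 0)
    (h : C c * quintic ![a 0 * t⁻¹ ^ 5, a 1 * t * t⁻¹ ^ 4, a 2 * t ^ 2 * t⁻¹ ^ 3,
      a 3 * t ^ 3 * t⁻¹ ^ 2, a 4 * t ^ 4 * t⁻¹, a 5 * t ^ 5] = g) :
    EquivForm (quintic a) g := by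
  refine ⟨⟨!![t, 0; 0, t⁻¹], by simp [Matrix.det_fin_two_of, ht]⟩, c, hc, ?_⟩
  rw [← h]
  congr 1
  exact matAct_diag_quintic _ _ _

lemma exists_ne_zero_pow_eq {n : ℕ} (hn : 0 < n) {z : ℂ} (hz : z ≠ 0) :
    ∃ t : ℂ, t ≠ 0 ∧ t ^ n = z := by
  obtain ⟨t, ht⟩ := IsAlgClosed.exists_pow_nat_eq z hn
  refine ⟨t, ?_, ht⟩
  rintro rfl
  exact hz (by rw [← ht, zero_pow hn.ne'])

lemma hasNormalForm_zero_five {a : Fin 6 → ℂ} (h0 : a 0 ≠ 0) (h5 : a 5 ≠ 0)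
    (h1 : a 1 = 0) (h2 : a 2 = 0) (h3 : a 3 = 0) (h4 : a 4 = 0) :
    HasNormalForm (quintic a) := by
  obtain ⟨t, ht, hpow⟩ := exists_ne_zero_pow_eq (n := 10) (by norm_num) (div_ne_zero h0 h5)
  refine Or.inr (Or.inr (Or.inr (Or.inr ?_)))
  refine EquivForm.of_scaling (c := (a 5 * t ^ 5)⁻¹) ht (by positivity) ?_
  have e : (a 5 * t ^ 5)⁻¹ * (a 0 * t⁻¹ ^ 5) = 1 := by field_simp at hpow ⊢; grind
  have e' : (a 5 * t ^ 5)⁻¹ * (a 5 * t ^ 5) = 1 := by field_simp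
  rw [C_mul_quintic]
  simp only [quintic, Matrix.cons_val, h1, h2, h3, h4, e, e', map_one, mul_zero, zero_mul, map_zero]
  ring

lemma hasNormalForm_one_four {a : Fin 6 → ℂ} (h1 : a 1 ≠ 0) (h4 : a 4 ≠ 0)
    (h0 : a 0 = 0) (h2 : a 2 = 0) (h3 : a 3 = 0) (h5 : a 5 = 0) :
    HasNormalForm (quintic a) := by
  obtain ⟨t, ht, hpow⟩ := exists_ne_zero_pow_eq (n := 6) (by norm_num) (div_ne_zero h1 h4)
  refine Or.inr (Or.inr (Or.inr (Or.inl ?_)))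
  refine EquivForm.of_scaling (c := (a 4 * t ^ 4 * t⁻¹)⁻¹) ht (by positivity) ?_
  have e : (a 4 * t ^ 4 * t⁻¹)⁻¹ * (a 1 * t * t⁻¹ ^ 4) = 1 := by field_simp at hpow ⊢; grind
  have e' : (a 4 * t ^ 4 * t⁻¹)⁻¹ * (a 4 * t ^ 4 * t⁻¹) = 1 := by field_simp
  rw [C_mul_quintic]
  simp only [quintic, Matrix.cons_val, h0, h2, h3, h5, e, e', map_one, mul_zero, zero_mul, map_zero]
  ring

lemma hasNormalForm_two_five {a : Fin 6 → ℂ} (h2 : a 2 ≠ 0) (h5 : a 5 ≠ 0)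
    (h0 : a 0 = 0) (h1 : a 1 = 0) (h3 : a 3 = 0) (h4 : a 4 = 0) :
    HasNormalForm (quintic a) := by
  obtain ⟨t, ht, hpow⟩ := exists_ne_zero_pow_eq (n := 6) (by norm_num) (div_ne_zero h2 h5)
  refine Or.inr (Or.inl ?_)
  refine EquivForm.of_scaling (c := (a 5 * t ^ 5)⁻¹) ht (by positivity) ?_
  have e : (a 5 * t ^ 5)⁻¹ * (a 2 * t ^ 2 * t⁻¹ ^ 3) = 1 := by field_simp at hpow ⊢; grind
  have e' : (a 5 * t ^ 5)⁻¹ * (a 5 * t ^ 5) = 1 := by field_simp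
  rw [C_mul_quintic]
  simp only [quintic, Matrix.cons_val, h0, h1, h3, h4, e, e', map_one, mul_zero, zero_mul, map_zero]
  ring

lemma exists_quadratic_root {a b c : ℂ} (h : a ≠ 0) : ∃ z : ℂ, a * z ^ 2 + b * z + c = 0 := by
  obtain ⟨s, hs⟩ := IsAlgClosed.exists_pow_nat_eq (discrim a b c) (n := 2) (by norm_num)
  obtain ⟨z, hz⟩ := exists_quadratic_eq_zero h ⟨s, by rw [← hs, sq]⟩
  exact ⟨z, by linear_combination hz⟩

lemma hasNormalForm_odd {a : Fin 6 → ℂ} (h1 : a 1 ≠ 0) (h35 : a 3 ≠ 0 ∨ a 5 ≠ 0)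
    (h0 : a 0 = 0) (h2 : a 2 = 0) (h4 : a 4 = 0) : HasNormalForm (quintic a) := by
  obtain ⟨r, hr⟩ : ∃ r : ℂ, a 5 * r ^ 2 + a 3 * r + a 1 = 0 := by
    by_cases h5 : a 5 = 0
    · have h3 : a 3 ≠ 0 := by tauto
      exact ⟨-a 1 / a 3, by rw [h5]; field_simp; ring⟩
    · exact exists_quadratic_root h5
  have hr0 : r ≠ 0 := by
    rintro rfl
    exact h1 (by linear_combination hr)
  obtain ⟨t, ht, hpow⟩ := exists_ne_zero_pow_eq (n := 4) (by norm_num) (neg_ne_zero.mpr hr0)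
  refine Or.inl ⟨a 5 * t ^ 5, -(t * a 1 / r), ?_, ?_⟩
  · simp [h1, hr0, ht]
  refine EquivForm.of_scaling (c := 1) ht one_ne_zero ?_
  have e1 : a 1 * t * t⁻¹ ^ 4 = -(t * a 1 / r) := by field_simp; grind
  have e3 : a 3 * t ^ 3 * t⁻¹ ^ 2 = a 5 * t ^ 5 + -(t * a 1 / r) := by field_simp; grind
  simp only [e1, e3, h0, h2, h4]
  simp only [quintic, map_one, Matrix.cons_val, zero_mul, map_zero]
  simp only [map_add]
  ring

lemma hasNormalForm_even {a : Fin 6 → ℂ} (h4 : a 4 ≠ 0) (h02 : a 0 ≠ 0 ∨ a 2 ≠ 0)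
    (h1 : a 1 = 0) (h3 : a 3 = 0) (h5 : a 5 = 0) : HasNormalForm (quintic a) := by
  apply HasNormalForm.of_swap
  apply hasNormalForm_odd <;> simp [*]
  tauto

lemma NoTripleFactor.exists_low {a : Fin 6 → ℂ} (h : NoTripleFactor (quintic a)) :
    a 0 ≠ 0 ∨ a 1 ≠ 0 ∨ a 2 ≠ 0 := by
  by_contra! hc
  obtain ⟨h0, h1, h2⟩ := hc
  refine h 1 0 (by simp) ⟨C (a 3) * Py ^ 2 + C (a 4) * (Px * Py) + C (a 5) * Px ^ 2, ?_⟩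
  simp [quintic, h0, h1, h2]
  ring

lemma NoTripleFactor.exists_high {a : Fin 6 → ℂ} (h : NoTripleFactor (quintic a)) :
    a 3 ≠ 0 ∨ a 4 ≠ 0 ∨ a 5 ≠ 0 := by
  by_contra! hc
  obtain ⟨h3, h4, h5⟩ := hc
  refine h 0 1 (by simp) ⟨C (a 0) * Py ^ 2 + C (a 1) * (Px * Py) + C (a 2) * Px ^ 2, ?_⟩
  simp [quintic, h3, h4, h5]
  ring

lemma SemiInv.upper_coeffs {a : Fin 6 → ℂ} {α b δ : ℂ}
    (h : SemiInv !![α, b; 0, δ] (quintic a)) : ∃ c : ℂ, c ≠ 0 ∧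
      a 0 * δ ^ 5 + a 1 * b * δ ^ 4 + a 2 * b ^ 2 * δ ^ 3 + a 3 * b ^ 3 * δ ^ 2 +
          a 4 * b ^ 4 * δ + a 5 * b ^ 5 = c * a 0 ∧
      a 1 * α * δ ^ 4 + 2 * a 2 * α * b * δ ^ 3 + 3 * a 3 * α * b ^ 2 * δ ^ 2 +
          4 * a 4 * α * b ^ 3 * δ + 5 * a 5 * α * b ^ 4 = c * a 1 ∧
      a 2 * α ^ 2 * δ ^ 3 + 3 * a 3 * α ^ 2 * b * δ ^ 2 + 6 * a 4 * α ^ 2 * b ^ 2 * δ +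
          10 * a 5 * α ^ 2 * b ^ 3 = c * a 2 ∧
      a 3 * α ^ 3 * δ ^ 2 + 4 * a 4 * α ^ 3 * b * δ + 10 * a 5 * α ^ 3 * b ^ 2 = c * a 3 ∧
      a 4 * α ^ 4 * δ + 5 * a 5 * α ^ 4 * b = c * a 4 ∧
      a 5 * α ^ 5 = c * a 5 := by
  obtain ⟨c, hc, h⟩ := h
  rw [matAct_upper_quintic, C_mul_quintic] at h
  have h := quintic_injective h
  exact ⟨c, hc, congrFun h 0, congrFun h 1, congrFun h 2, congrFun h 3, congrFun h 4,
    congrFun h 5⟩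

/-- A quintic semi-invariant under a nontrivial unipotent matrix, up to sign, has a triple
factor. -/
lemma not_semiInv_unipotent {a : Fin 6 → ℂ} {α b : ℂ} (hα : α ≠ 0) (hb : b ≠ 0)
    (hs : NoTripleFactor (quintic a)) : ¬ SemiInv !![α, b; 0, α] (quintic a) := by
  intro h
  obtain ⟨c, hc, -, -, e2, e3, e4, e5⟩ := h.upper_coeffs
  have h5 : a 5 = 0 := by
    by_contra h5
    have hcα : c = α ^ 5 := mul_right_cancel₀ h5 (by linear_combination -e5)
    have : 5 * a 5 * α ^ 4 * b = 0 := by rw [hcα] at e4; linear_combination e4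
    simp_all
  have h4 : a 4 = 0 := by
    by_contra h4
    have hcα : c = α ^ 5 := mul_right_cancel₀ h4 (by rw [h5] at e4; linear_combination -e4)
    have : 4 * a 4 * α ^ 4 * b = 0 := by rw [hcα, h5] at e3; linear_combination e3
    simp_all
  have h3 : a 3 = 0 := by
    by_contra h3
    have hcα : c = α ^ 5 :=
      mul_right_cancel₀ h3 (by rw [h5, h4] at e3; linear_combination -e3)
    have : 3 * a 3 * α ^ 4 * b = 0 := by rw [hcα, h5, h4] at e2; linear_combination e2
    simp_all
  rcases hs.exists_high with h | h | h <;> contradiction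

lemma hasNormalForm_of_semiInv_diag {a : Fin 6 → ℂ} {α δ : ℂ} (hdet : α * δ = 1) (hne : α ≠ δ)
    (hs : NoTripleFactor (quintic a)) (h : SemiInv !![α, 0; 0, δ] (quintic a)) :
    HasNormalForm (quintic a) := by
  have hα : α ≠ 0 := left_ne_zero_of_mul_eq_one hdet
  obtain ⟨z, hz⟩ : ∃ z, z = α ^ 2 := ⟨_, rfl⟩
  have hz1 : z ≠ 1 := fun h1 => hne (mul_left_cancel₀ hα (by rw [hdet, ← sq, ← hz, h1]))
  have hz0 : z ≠ 0 := hz ▸ pow_ne_zero 2 hα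
  obtain ⟨c, hc, e0, e1, e2, e3, e4, e5⟩ := h.upper_coeffs
  obtain ⟨w, hw⟩ : ∃ w, w = c * α ^ 5 := ⟨_, rfl⟩
  have hpow : ∀ n : ℕ, (α * δ) ^ n = 1 := fun n => by rw [hdet, one_pow]
  have w0 : a 0 ≠ 0 → w = 1 := fun h => mul_right_cancel₀ h <| by
    rw [hw]
    linear_combination -α ^ 5 * e0 + a 0 * hpow 5
  have w1 : a 1 ≠ 0 → w = z := fun h => mul_right_cancel₀ h <| by
    rw [hw, hz]
    linear_combination -α ^ 5 * e1 + a 1 * α ^ 2 * hpow 4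
  have w2 : a 2 ≠ 0 → w = z ^ 2 := fun h => mul_right_cancel₀ h <| by
    rw [hw, hz]
    linear_combination -α ^ 5 * e2 + a 2 * α ^ 4 * hpow 3
  have w3 : a 3 ≠ 0 → w = z ^ 3 := fun h => mul_right_cancel₀ h <| by
    rw [hw, hz]
    linear_combination -α ^ 5 * e3 + a 3 * α ^ 6 * hpow 2
  have w4 : a 4 ≠ 0 → w = z ^ 4 := fun h => mul_right_cancel₀ h <| by
    rw [hw, hz]
    linear_combination -α ^ 5 * e4 + a 4 * α ^ 8 * hpow 1
  have w5 : a 5 ≠ 0 → w = z ^ 5 := fun h => mul_right_cancel₀ h <| by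
    rw [hw, hz]
    linear_combination -α ^ 5 * e5 + a 5 * α ^ 10 * hpow 0
  clear e0 e1 e2 e3 e4 e5 hw hz hne hdet hpow h
  rcases hs.exists_low with h | h | h <;> rcases hs.exists_high with h' | h' | h'
  · refine HasNormalForm.of_swap (hasNormalForm_two_five ?_ ?_ ?_ ?_ ?_ ?_) <;>
      simp only [Matrix.cons_val, ne_eq, neg_eq_zero] <;> grind
  · apply hasNormalForm_even <;> grind
  · apply hasNormalForm_zero_five <;> grind
  · apply hasNormalForm_odd <;> grind
  · apply hasNormalForm_one_four <;> grind
  · apply hasNormalForm_odd <;> grind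
  · grind
  · apply hasNormalForm_even <;> grind
  · apply hasNormalForm_two_five <;> grind

/-- Every `2 × 2` matrix is conjugate in `SL(2,ℂ)` to an upper triangular one. -/
lemma exists_conj_upper (A : Matrix (Fin 2) (Fin 2) ℂ) :
    ∃ P T : Matrix (Fin 2) (Fin 2) ℂ, P.det = 1 ∧ P * T = A * P ∧ T 1 0 = 0 := by
  by_cases hr : A 1 0 = 0
  · exact ⟨1, A, by simp, by simp, hr⟩
  obtain ⟨z, hz⟩ := exists_quadratic_root (b := A 1 1 - A 0 0) (c := -A 0 1) hr
  have hdet : (!![z, -1; 1, 0] : Matrix (Fin 2) (Fin 2) ℂ).det = 1 := by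
    simp [Matrix.det_fin_two_of]
  refine ⟨!![z, -1; 1, 0], Matrix.adjugate !![z, -1; 1, 0] * (A * !![z, -1; 1, 0]), hdet, ?_, ?_⟩
  · rw [← Matrix.mul_assoc, Matrix.mul_adjugate, hdet, one_smul, Matrix.one_mul]
  · simp [Matrix.adjugate_fin_two_of, Matrix.mul_apply, Fin.sum_univ_two]
    linear_combination hz

/-- An upper triangular matrix with distinct diagonal entries can be diagonalized. -/
lemma exists_conj_diag {α b δ : ℂ} (hne : α ≠ δ) : ∃ P : Matrix (Fin 2) (Fin 2) ℂ,
    P.det = 1 ∧ P * !![α, 0; 0, δ] = !![α, b; 0, δ] * P := by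
  have h : α - δ ≠ 0 := sub_ne_zero.mpr hne
  refine ⟨!![1, -b / (α - δ); 0, 1], by simp [Matrix.det_fin_two_of], ?_⟩
  ext i j
  fin_cases i <;> fin_cases j <;> simp [Matrix.mul_apply, Fin.sum_univ_two]
  field_simp
  ring

lemma matAct_isHomogeneous {f : BPoly} {n : ℕ} (hf : f.IsHomogeneous n)
    (A : Matrix (Fin 2) (Fin 2) ℂ) : (matAct A f).IsHomogeneous n := by
  have h : ∀ i, (C (A i 0) * Px + C (A i 1) * Py).IsHomogeneous 1 := fun i =>
    ((isHomogeneous_X ℂ 0).C_mul _).add ((isHomogeneous_X ℂ 1).C_mul _)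
  simpa using! hf.aeval _ h

lemma det_eq_of_mul_eq_mul {A P T : Matrix (Fin 2) (Fin 2) ℂ} (hP : P.det = 1)
    (h : P * T = A * P) : T.det = A.det := by
  simpa [hP] using congrArg Matrix.det h

lemma hasNormalForm_of_semiInv_upper {f : BPoly} {α b δ : ℂ} (hdet : α * δ = 1)
    (htriv : α = δ → b ≠ 0) (hs : NoTripleFactor f) (hf : f.IsHomogeneous 5)
    (h : SemiInv !![α, b; 0, δ] f) : HasNormalForm f := by
  by_cases hne : α = δ
  · subst hne
    obtain ⟨a, rfl⟩ := exists_eq_quintic hf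
    exact absurd h (not_semiInv_unipotent (left_ne_zero_of_mul_eq_one hdet) (htriv rfl) hs)
  · obtain ⟨P, hP, hPT⟩ := exists_conj_diag (b := b) hne
    have h' := h.conj hPT
    have hs' := hs.matAct hP
    refine HasNormalForm.of_matAct hP ?_
    obtain ⟨a, ha⟩ := exists_eq_quintic (matAct_isHomogeneous hf P)
    rw [ha] at h' hs' ⊢
    exact hasNormalForm_of_semiInv_diag hdet hne hs' h'

lemma hasNormalForm_of_semiInv {f : BPoly} {A : Matrix (Fin 2) (Fin 2) ℂ} (hA : A.det = 1)
    (h1 : A ≠ 1) (h2 : A ≠ -1) (hs : NoTripleFactor f) (hf : f.IsHomogeneous 5)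
    (h : SemiInv A f) : HasNormalForm f := by
  obtain ⟨P, T, hP, hPT, hT⟩ := exists_conj_upper A
  refine HasNormalForm.of_matAct hP ?_
  have hTe : T = !![T 0 0, T 0 1; 0, T 1 1] := by rw [← hT]; exact Matrix.eta_fin_two T
  have hdet : T 0 0 * T 1 1 = 1 := by
    have := det_eq_of_mul_eq_mul hP hPT
    rw [hA, Matrix.det_fin_two, hT] at this
    linear_combination this
  refine hasNormalForm_of_semiInv_upper (α := T 0 0) (b := T 0 1) (δ := T 1 1) hdet ?_
    (hs.matAct hP) (matAct_isHomogeneous hf P) (hTe ▸ h.conj hPT)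
  intro he hb
  have hscalar : T = T 0 0 • (1 : Matrix (Fin 2) (Fin 2) ℂ) := by
    ext i j
    fin_cases i <;> fin_cases j <;> simp [hT, hb, he]
  have hAs : A = T 0 0 • (1 : Matrix (Fin 2) (Fin 2) ℂ) := by
    have := congrArg (· * P.adjugate) hPT
    simp only [Matrix.mul_assoc, Matrix.mul_adjugate, hP, one_smul, Matrix.mul_one] at this
    rw [← this, hscalar]
    simp [Matrix.mul_adjugate, hP]
  rw [← he] at hdet
  rcases mul_self_eq_one_iff.mp hdet with h | h
  · exact h1 (by rw [hAs, h, one_smul])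
  · exact h2 (by rw [hAs, h, neg_smul, one_smul])

/-- Classification of stable binary quintics with extra symmetries: if a binary
quintic with all roots of multiplicity at most 2 has stabilizer strictly
containing `{I, -I}`, then it is `SL(2,ℂ)`-equivalent up to a nonzero scalar to
one of the five listed normal forms. -/
theorem stable_quintic_extra_symmetry
    (f : BPoly) (hf0 : f ≠ 0) (hf5 : f.IsHomogeneous 5)
    (hstable : ∀ a b : ℂ, (a, b) ≠ (0, 0) → ¬((C a * Px + C b * Py) ^ 3 ∣ f))
    (hbig : {A : SpecialLinearGroup (Fin 2) ℂ |
      (A : Matrix (Fin 2) (Fin 2) ℂ) = 1 ∨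
      (A : Matrix (Fin 2) (Fin 2) ℂ) = -1} ⊂ Stab f) :
    (∃ lam mu : ℂ, (lam, mu) ≠ (0, 0) ∧
      EquivForm f (Px * (Px ^ 2 + Py ^ 2) * (C lam * Px ^ 2 + C mu * Py ^ 2))) ∨
    EquivForm f (Px ^ 2 * (Px ^ 3 + Py ^ 3)) ∨
    EquivForm f (Px * (Px ^ 4 + Py ^ 4)) ∨
    EquivForm f (Px * Py * (Px ^ 3 + Py ^ 3)) ∨
    EquivForm f (Px ^ 5 + Py ^ 5) := by
  obtain ⟨A, hA, hA'⟩ := Set.exists_of_ssubset hbig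
  exact hasNormalForm_of_semiInv A.det_coe (fun h => hA' (Or.inl h)) (fun h => hA' (Or.inr h))
    hstable hf5 hA

end
end

section
/- Let f ∈ ℂ[x,y] be a binary sextic all of whose linear factors occur with multiplicity at most 2 (a stable sextic). If the stabilizer Stab(f) ⊂ SL(2,ℂ) strictly contains {I, −I}, then f is SL(2,ℂ)-equivalent up to a nonzero scalar to one of the following forms: (I) (x²+y²)(λ₁x²+μ₁y²)(λ₂x²+μ₂y²) for some (λᵢ,μᵢ) ∈ ℂ² \ {(0,0)}; (II) x(x⁵+y⁵); (III) xy(λ(x²+y²)² + μ(x²−y²)²) for some (λ,μ) ≠ (0,0); (IV) λ(x³+y³)² + μ(x³−y³)² for some (λ,μ) ≠ (0,0); (V) x⁶+y⁶; (VI) xy(x⁴−y⁴); (VII) x²y(x³+y³); (VIII) x²(x⁴+y⁴). -/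
open MvPolynomial Matrix

noncomputable section

namespace BinarySextic

/-- The binary sextic `∑ aᵢ xⁱ y⁶⁻ⁱ`. -/
def sextic (a : ℕ → ℂ) : BPoly :=
  ∑ i ∈ Finset.range 7, C (a i) * Px ^ i * Py ^ (6 - i)

lemma eval_matAct (A : Matrix (Fin 2) (Fin 2) ℂ) (f : BPoly) (v : Fin 2 → ℂ) :
    eval v (matAct A f) = eval (fun i => A i 0 * v 0 + A i 1 * v 1) f := by
  unfold matAct
  rw [← coe_aeval_eq_eval, ← coe_aeval_eq_eval]
  simp only [RingHom.coe_coe, aeval_bind₁]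
  simp [Px, Py]

lemma eval_sextic (a : ℕ → ℂ) (v : Fin 2 → ℂ) :
    eval v (sextic a) = ∑ i ∈ Finset.range 7, a i * v 0 ^ i * v 1 ^ (6 - i) := by
  simp [sextic, Px, Py]

lemma matAct_matAct (A B : Matrix (Fin 2) (Fin 2) ℂ) (f : BPoly) :
    matAct B (matAct A f) = matAct (A * B) f := by
  refine MvPolynomial.funext fun v => ?_
  simp only [eval_matAct, Matrix.mul_apply, Fin.sum_univ_two]
  congr 2
  funext i
  ring

lemma matAct_matAct_coe (A B : SpecialLinearGroup (Fin 2) ℂ) (f : BPoly) :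
    matAct (B : Matrix (Fin 2) (Fin 2) ℂ) (matAct (A : Matrix (Fin 2) (Fin 2) ℂ) f) =
      matAct ((A * B : SpecialLinearGroup (Fin 2) ℂ) : Matrix (Fin 2) (Fin 2) ℂ) f :=
  matAct_matAct _ _ _

lemma mul_apply_two (A B : SpecialLinearGroup (Fin 2) ℂ) (i j : Fin 2) :
    (A * B) i j = A i 0 * B 0 j + A i 1 * B 1 j :=
  (Matrix.mul_apply (M := A.1) (N := B.1)).trans (Fin.sum_univ_two _)

lemma det_eq_one (B : SpecialLinearGroup (Fin 2) ℂ) : B 0 0 * B 1 1 - B 0 1 * B 1 0 = 1 :=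
  (Matrix.det_fin_two B.1).symm.trans B.2

lemma inv_apply_two (A : SpecialLinearGroup (Fin 2) ℂ) :
    A⁻¹ 0 0 = A 1 1 ∧ A⁻¹ 0 1 = -A 0 1 ∧ A⁻¹ 1 0 = -A 1 0 ∧ A⁻¹ 1 1 = A 0 0 := by
  have h : (A⁻¹).1 = !![A 1 1, -A 0 1; -A 1 0, A 0 0] := Matrix.adjugate_fin_two A.1
  simp [h]

lemma matAct_one (f : BPoly) : matAct 1 f = f := by
  refine MvPolynomial.funext fun v => ?_
  rw [eval_matAct]
  congr 2
  funext i
  fin_cases i <;> simp [Matrix.one_apply]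

lemma matAct_mul (A : Matrix (Fin 2) (Fin 2) ℂ) (f g : BPoly) :
    matAct A (f * g) = matAct A f * matAct A g := map_mul _ _ _

lemma matAct_C_mul (A : Matrix (Fin 2) (Fin 2) ℂ) (c : ℂ) (f : BPoly) :
    matAct A (C c * f) = C c * matAct A f := by
  simp [matAct]

lemma isHomogeneous_matAct (A : Matrix (Fin 2) (Fin 2) ℂ) {f : BPoly} {n : ℕ}
    (hf : f.IsHomogeneous n) : (matAct A f).IsHomogeneous n := by
  have h := hf.aeval (fun i => C (A i 0) * Px + C (A i 1) * Py) (n := 1) fun i =>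
    (((isHomogeneous_C _ _).mul (isHomogeneous_X _ _)).add
      ((isHomogeneous_C _ _).mul (isHomogeneous_X _ _)))
  rwa [one_mul] at h

/-- No nonzero linear form divides `f` with multiplicity at least three. -/
def Stable (f : BPoly) : Prop :=
  ∀ a b : ℂ, (a, b) ≠ (0, 0) → ¬((C a * Px + C b * Py) ^ 3 ∣ f)

lemma Stable.matAct {f : BPoly} (hf : Stable f) (P : SpecialLinearGroup (Fin 2) ℂ) :
    Stable (matAct (P : Matrix (Fin 2) (Fin 2) ℂ) f) := by
  rintro a b hab ⟨g, hg⟩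
  let Q : Matrix (Fin 2) (Fin 2) ℂ := (P⁻¹).1
  have hPQ : P.1 * Q = 1 := congrArg Subtype.val (mul_inv_cancel P)
  have hdet : Q 0 0 * Q 1 1 - Q 0 1 * Q 1 0 = 1 := det_eq_one P⁻¹
  refine hf (a * Q 0 0 + b * Q 1 0) (a * Q 0 1 + b * Q 1 1) ?_ ⟨_root_.matAct Q g, ?_⟩
  · intro h
    simp only [Prod.mk.injEq] at h
    apply hab
    have h1 : a = 0 := by linear_combination Q 1 1 * h.1 - Q 1 0 * h.2 - a * hdet
    have h2 : b = 0 := by linear_combination -Q 0 1 * h.1 + Q 0 0 * h.2 - b * hdet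
    rw [h1, h2]
  · have h := congrArg (_root_.matAct Q) hg
    rw [matAct_matAct, hPQ, matAct_one, matAct_mul] at h
    rw [h]
    refine congrArg (· * _root_.matAct Q g) (MvPolynomial.funext fun v => ?_)
    simp only [eval_matAct]
    simp [Px, Py]
    ring

lemma EquivForm.of_matAct {f g : BPoly} (P : SpecialLinearGroup (Fin 2) ℂ)
    (h : EquivForm (matAct (P : Matrix (Fin 2) (Fin 2) ℂ) f) g) : EquivForm f g := by
  obtain ⟨A, c, hc, h⟩ := h
  refine ⟨P * A, c, hc, ?_⟩
  rw [← h, matAct_matAct_coe]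

lemma exists_eq_sextic {f : BPoly} (hf : f.IsHomogeneous 6) : ∃ a, f = sextic a := by
  rw [f.as_sum]
  refine Finset.sum_induction _ (fun g => ∃ a, g = sextic a) ?_ ?_ ?_
  · rintro _ _ ⟨a, rfl⟩ ⟨b, rfl⟩
    exact ⟨a + b, by simp [sextic, add_mul, Finset.sum_add_distrib]⟩
  · exact ⟨0, by simp [sextic]⟩
  · intro d hd
    have hdeg : d 0 + d 1 = 6 := by
      have := hf (mem_support_iff.mp hd)
      simpa [Finsupp.weight_apply, Finsupp.sum_fintype] using this
    refine ⟨Pi.single (d 0) (coeff d f), ?_⟩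
    have h0 : d 0 ∈ Finset.range 7 := by simp; omega
    rw [sextic, Finset.sum_eq_single_of_mem _ h0 (fun i _ hi => by simp [hi])]
    rw [monomial_eq, Finsupp.prod_fintype _ _ (by simp)]
    have h1 : 6 - d 0 = d 1 := by omega
    simp [Px, Py, h1, mul_assoc]

/-- The dehomogenization `y = 1` of a binary form. -/
def dehom : BPoly →ₐ[ℂ] Polynomial ℂ := aeval ![Polynomial.X, 1]

lemma dehom_sextic (a : ℕ → ℂ) :
    dehom (sextic a) = ∑ i ∈ Finset.range 7, Polynomial.C (a i) * Polynomial.X ^ i := by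
  simp [dehom, sextic, Px, Py, Polynomial.algebraMap_eq]

lemma coeff_dehom_sextic (a : ℕ → ℂ) {i : ℕ} (hi : i < 7) :
    (dehom (sextic a)).coeff i = a i := by
  rw [dehom_sextic, Polynomial.finsetSum_coeff]
  simp [Polynomial.coeff_C_mul, Polynomial.coeff_X_pow, hi]

lemma eval_dehom (f : BPoly) (x : ℂ) : (dehom f).eval x = eval ![x, 1] f := by
  induction f using MvPolynomial.induction_on with
  | C a => simp [dehom, Polynomial.algebraMap_eq]
  | add p q hp hq => simp [hp, hq]
  | mul_X p i hp =>
    rw [map_mul, map_mul, Polynomial.eval_mul, hp]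
    congr 1
    fin_cases i <;> simp [dehom]

lemma sextic_coeff_congr {a b : ℕ → ℂ} (h : sextic a = sextic b) {i : ℕ} (hi : i < 7) :
    a i = b i := by
  rw [← coeff_dehom_sextic a hi, h, coeff_dehom_sextic b hi]

lemma Stable.low {a : ℕ → ℂ} (h : Stable (sextic a)) : a 0 ≠ 0 ∨ a 1 ≠ 0 ∨ a 2 ≠ 0 := by
  by_contra! hn
  obtain ⟨h0, h1, h2⟩ := hn
  refine h 1 0 (by simp) ⟨C (a 3) * Py ^ 3 + C (a 4) * Px * Py ^ 2 + C (a 5) * Px ^ 2 * Py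
    + C (a 6) * Px ^ 3, ?_⟩
  simp [sextic, Finset.sum_range_succ, h0, h1, h2]
  ring

lemma Stable.high {a : ℕ → ℂ} (h : Stable (sextic a)) : a 4 ≠ 0 ∨ a 5 ≠ 0 ∨ a 6 ≠ 0 := by
  by_contra! hn
  obtain ⟨h0, h1, h2⟩ := hn
  refine h 0 1 (by simp) ⟨C (a 3) * Px ^ 3 + C (a 2) * Py * Px ^ 2 + C (a 1) * Py ^ 2 * Px
    + C (a 0) * Py ^ 3, ?_⟩
  simp [sextic, Finset.sum_range_succ, h0, h1, h2]
  ring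

/-- A polynomial whose roots are permuted by a nontrivial translation is constant. -/
lemma natDegree_eq_zero_of_translation {p : Polynomial ℂ} {b : ℂ} (hb : b ≠ 0)
    (h : ∀ x, p.eval x = 0 → p.eval (x + b) = 0) : p.natDegree = 0 := by
  by_contra hd
  have hp : p ≠ 0 := by rintro rfl; simp at hd
  obtain ⟨r, hr⟩ := IsAlgClosed.exists_root p (fun h0 => hd (Polynomial.natDegree_eq_of_degree_eq_some h0))
  have hroot : ∀ n : ℕ, p.eval (r + n * b) = 0 := by
    intro n
    induction n with
    | zero => simpa using hr
    | succ n ih =>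
      have := h _ ih
      push_cast
      convert this using 2
      ring
  refine hp (Polynomial.eq_zero_of_infinite_isRoot p ?_)
  refine (Set.infinite_range_of_injective (f := fun n : ℕ => r + n * b) ?_).mono ?_
  · intro m n hmn
    simpa [hb] using hmn
  · rintro _ ⟨n, rfl⟩
    exact hroot n

/-- Every element of `SL(2,ℂ)` is conjugate to an upper triangular matrix. -/
lemma exists_conj_upper (A : SpecialLinearGroup (Fin 2) ℂ) :
    ∃ P : SpecialLinearGroup (Fin 2) ℂ, (P⁻¹ * A * P) 1 0 = 0 := by
  obtain ⟨t, ht⟩ := IsAlgClosed.exists_root (A : Matrix (Fin 2) (Fin 2) ℂ).charpoly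
    (by rw [Matrix.charpoly_degree_eq_dim]; simp)
  rw [Polynomial.IsRoot, Matrix.eval_charpoly] at ht
  obtain ⟨v, hv, hv0⟩ := Matrix.exists_mulVec_eq_zero_iff.mpr ht
  have hcop : IsCoprime (v 0) (v 1) := by
    by_cases h0 : v 0 = 0
    · have h1 : v 1 ≠ 0 := by
        intro h1
        apply hv
        funext i
        fin_cases i <;> simp [h0, h1]
      exact ⟨0, (v 1)⁻¹, by simp [h1]⟩
    · exact ⟨(v 0)⁻¹, 0, by simp [h0]⟩
  obtain ⟨P, hP0, hP1⟩ := hcop.exists_SL2_col 0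
  refine ⟨P, ?_⟩
  have e0 := congrFun hv0 0
  have e1 := congrFun hv0 1
  simp [Matrix.mulVec, dotProduct, Fin.sum_univ_two] at e0 e1
  obtain ⟨-, -, i0, i1⟩ := inv_apply_two P
  simp only [mul_apply_two, i0, i1, hP0, hP1]
  linear_combination v 1 * e0 - v 0 * e1

lemma semiInv_conj {f : BPoly} {A P : SpecialLinearGroup (Fin 2) ℂ} (h : A ∈ Stab f) :
    P⁻¹ * A * P ∈ Stab (matAct (P : Matrix (Fin 2) (Fin 2) ℂ) f) := by
  obtain ⟨c, hc, h⟩ := h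
  refine ⟨c, hc, ?_⟩
  have e : P * (P⁻¹ * A * P) = A * P := by group
  rw [matAct_matAct_coe, ← matAct_C_mul, ← h, matAct_matAct_coe, e]

lemma eq_one_or_neg_one_of_diag {B : SpecialLinearGroup (Fin 2) ℂ} (h10 : B 1 0 = 0)
    (h01 : B 0 1 = 0) (h : B 0 0 ^ 2 = 1) : B = 1 ∨ B = -1 := by
  have hdet := det_eq_one B
  rw [h10, h01] at hdet
  rcases sq_eq_one_iff.mp h with h | h
  · left
    ext i j
    fin_cases i <;> fin_cases j <;> simp_all
  · right
    ext i j
    fin_cases i <;> fin_cases j <;> simp_all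
    linear_combination -hdet

/-- The upper unitriangular matrix with off-diagonal entry `w`. -/
def shear (w : ℂ) : SpecialLinearGroup (Fin 2) ℂ :=
  ⟨!![1, w; 0, 1], by simp [Matrix.det_fin_two]⟩

/-- A stable sextic has no nontrivial parabolic symmetry. -/
lemma sq_ne_one_of_upper {a : ℕ → ℂ} (ha : Stable (sextic a))
    {B : SpecialLinearGroup (Fin 2) ℂ} (hB : B ∈ Stab (sextic a)) (h1 : B ≠ 1) (h2 : B ≠ -1)
    (h10 : B 1 0 = 0) : B 0 0 ^ 2 ≠ 1 := by
  intro ht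
  have hb : B 0 1 ≠ 0 := fun h01 => (eq_one_or_neg_one_of_diag h10 h01 ht).elim h1 h2
  have hdet := det_eq_one B
  rw [h10] at hdet
  have hs : B 1 1 = B 0 0 := by linear_combination B 0 0 * hdet - B 1 1 * ht
  have ht0 : B 0 0 ≠ 0 := by rintro h; simp [h] at ht
  obtain ⟨c, hc, h⟩ := hB
  have hd : (dehom (sextic a)).natDegree = 0 := by
    refine natDegree_eq_zero_of_translation (mul_ne_zero ht0 hb) fun x hx => ?_
    rw [eval_dehom] at hx ⊢
    have hx' := congrArg (eval ![x, 1]) h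
    rw [eval_matAct, map_mul, hx, mul_zero] at hx'
    rw [← hx', eval_sextic, eval_sextic]
    rcases sq_eq_one_iff.mp ht with h | h
    · simp [hs, h10, h]
    · simp [hs, h10, h, Finset.sum_range_succ]
      ring
  have hz : ∀ i, i < 7 → i ≠ 0 → a i = 0 := fun i hi hi0 => by
    rw [← coeff_dehom_sextic a hi]
    exact Polynomial.coeff_eq_zero_of_natDegree_lt (by omega)
  rcases ha.high with h | h | h
  · exact h (hz 4 (by norm_num) (by norm_num))
  · exact h (hz 5 (by norm_num) (by norm_num))
  · exact h (hz 6 (by norm_num) (by norm_num))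

/-- A stable sextic with a noncentral symmetry has a nontrivial diagonal symmetry in
suitable coordinates. -/
lemma exists_diag_symmetry {f : BPoly} (hf6 : f.IsHomogeneous 6) (hf : Stable f)
    {A : SpecialLinearGroup (Fin 2) ℂ} (hA : A ∈ Stab f) (h1 : A ≠ 1) (h2 : A ≠ -1) :
    ∃ P B : SpecialLinearGroup (Fin 2) ℂ, B ∈ Stab (matAct (P : Matrix (Fin 2) (Fin 2) ℂ) f) ∧
      B 1 0 = 0 ∧ B 0 1 = 0 ∧ B 0 0 ^ 2 ≠ 1 := by
  obtain ⟨P, hP⟩ := exists_conj_upper A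
  set B := P⁻¹ * A * P with hBdef
  have hA' : A = P * B * P⁻¹ := by rw [hBdef]; group
  have hB : B ∈ Stab (matAct (P : Matrix (Fin 2) (Fin 2) ℂ) f) := semiInv_conj hA
  have ht : B 0 0 ^ 2 ≠ 1 := by
    obtain ⟨a, ha⟩ := exists_eq_sextic (isHomogeneous_matAct (P : Matrix (Fin 2) (Fin 2) ℂ) hf6)
    have hst := hf.matAct P
    rw [ha] at hst hB
    refine sq_ne_one_of_upper hst hB ?_ ?_ hP
    · intro h; apply h1; rw [hA', h]; group
    · intro h; apply h2; rw [hA', h]; simp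
  have hdet := det_eq_one B
  rw [hP] at hdet
  have hst : B 1 1 - B 0 0 ≠ 0 := fun h => ht (by linear_combination hdet - B 0 0 * h)
  let w := B 0 1 / (B 1 1 - B 0 0)
  let U := shear w
  obtain ⟨i00, i01, i10, i11⟩ := inv_apply_two U
  have u00 : U 0 0 = 1 := rfl
  have u01 : U 0 1 = B 0 1 / (B 1 1 - B 0 0) := rfl
  have u10 : U 1 0 = 0 := rfl
  have u11 : U 1 1 = 1 := rfl
  refine ⟨P * U, U⁻¹ * B * U, ?_, ?_, ?_, ?_⟩
  · rw [← matAct_matAct_coe]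
    exact semiInv_conj hB
  · simp only [mul_apply_two, i10, i11, u00, u10, hP]
    ring
  · simp only [mul_apply_two, i00, i01, u01, u11, hP]
    field_simp
    ring
  · simpa only [mul_apply_two, i00, i01, i10, i11, u00, u01, u10, u11, hP, one_mul, mul_one,
      mul_zero, add_zero, neg_zero] using ht

/-- The monomials of a form with a diagonal symmetry have congruent exponents. -/
lemma pow_sub_eq_one {a : ℕ → ℂ} {B : SpecialLinearGroup (Fin 2) ℂ} (hB : B ∈ Stab (sextic a))
    (h10 : B 1 0 = 0) (h01 : B 0 1 = 0) {i j : ℕ} (hij : i ≤ j) (hj : j < 7)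
    (hai : a i ≠ 0) (haj : a j ≠ 0) : (B 0 0 ^ 2) ^ (j - i) = 1 := by
  have hdet := det_eq_one B
  rw [h10, h01] at hdet
  have hts : B 0 0 * B 1 1 = 1 := by linear_combination hdet
  have ht0 : B 0 0 ≠ 0 := left_ne_zero_of_mul_eq_one hts
  obtain ⟨c, hc, h⟩ := hB
  have h' : sextic (fun i => a i * B 0 0 ^ i * B 1 1 ^ (6 - i)) = sextic (fun i => c * a i) := by
    rw [show sextic (fun i => c * a i) = C c * sextic a by
      simp [sextic, Finset.mul_sum, mul_assoc], ← h]
    refine MvPolynomial.funext fun v => ?_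
    rw [eval_matAct, eval_sextic, eval_sextic]
    refine Finset.sum_congr rfl fun i _ => ?_
    simp [h10, h01]
    ring
  have key : ∀ k, k < 7 → a k ≠ 0 → (B 0 0 ^ 2) ^ k = c * B 0 0 ^ 6 := fun k hk hak => by
    have e := sextic_coeff_congr h' hk
    have e2 : B 0 0 ^ (6 - k) * B 1 1 ^ (6 - k) = 1 := by rw [← mul_pow, hts, one_pow]
    have e3 : B 0 0 ^ 6 = B 0 0 ^ k * B 0 0 ^ (6 - k) := by rw [← pow_add]; congr 1; omega
    apply mul_left_cancel₀ hak
    rw [e3, ← pow_mul, mul_comm 2 k, pow_mul]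
    beta_reduce at e
    linear_combination B 0 0 ^ k * B 0 0 ^ (6 - k) * e - a k * (B 0 0 ^ k) ^ 2 * e2
  have hji : (B 0 0 ^ 2) ^ i * (B 0 0 ^ 2) ^ (j - i) = (B 0 0 ^ 2) ^ i * 1 := by
    rw [← pow_add, Nat.add_sub_cancel' hij, mul_one, key i (by omega) hai, key j hj haj]
  exact mul_left_cancel₀ (pow_ne_zero _ (pow_ne_zero _ ht0)) hji

lemma equivForm_sextic {a : ℕ → ℂ} {g : BPoly} {p q r s c : ℂ} (hdet : p * s - q * r = 1)
    (hc : c ≠ 0)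
    (h : ∀ x y : ℂ, c * ∑ i ∈ Finset.range 7, a i * (p * x + q * y) ^ i * (r * x + s * y) ^ (6 - i)
      = eval ![x, y] g) : EquivForm (sextic a) g := by
  refine ⟨⟨!![p, q; r, s], by simp [Matrix.det_fin_two, hdet]⟩, c, hc, ?_⟩
  refine MvPolynomial.funext fun v => ?_
  have hv : v = ![v 0, v 1] := by funext i; fin_cases i <;> rfl
  rw [hv, ← h, map_mul, eval_matAct, eval_sextic]
  simp

lemma exists_root_pow {z : ℂ} (hz : z ≠ 0) {n : ℕ} (hn : 0 < n) :
    ∃ p : ℂ, p ≠ 0 ∧ p ^ n = z := by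
  obtain ⟨p, hp⟩ := IsAlgClosed.exists_pow_nat_eq z hn
  exact ⟨p, by rintro rfl; simp [hn.ne'] at hp; exact hz hp.symm, hp⟩

/-- A nonzero binary quadratic form splits into nonzero linear factors. -/
lemma exists_factor_quadratic {a b c : ℂ} (h : a ≠ 0 ∨ b ≠ 0 ∨ c ≠ 0) :
    ∃ l₁ m₁ l₂ m₂ : ℂ, (l₁, m₁) ≠ (0, 0) ∧ (l₂, m₂) ≠ (0, 0) ∧
      a = l₁ * l₂ ∧ b = l₁ * m₂ + l₂ * m₁ ∧ c = m₁ * m₂ := by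
  by_cases ha : a = 0
  · refine ⟨0, 1, b, c, by simp, ?_, by simp [ha], by simp, by simp⟩
    simp only [ne_eq, Prod.mk.injEq]
    tauto
  · obtain ⟨s, hs⟩ := IsAlgClosed.exists_pow_nat_eq (discrim a b c) (n := 2) (by norm_num)
    obtain ⟨r, hr⟩ := exists_quadratic_eq_zero (a := a) (b := b) (c := c) ha ⟨s, by rw [← hs, sq]⟩
    exact ⟨1, -r, a, b + a * r, by simp, by simp [ha], by ring, by ring, by linear_combination hr⟩

/-- A cubic with nonzero constant term which is not constant has a nonzero root. -/
lemma exists_ne_zero_root {a b c d : ℂ} (hd : d ≠ 0) (h : a ≠ 0 ∨ b ≠ 0 ∨ c ≠ 0) :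
    ∃ r : ℂ, r ≠ 0 ∧ a * r ^ 3 + b * r ^ 2 + c * r + d = 0 := by
  let p : Polynomial ℂ := .C a * .X ^ 3 + .C b * .X ^ 2 + .C c * .X + .C d
  obtain ⟨r, hr⟩ := IsAlgClosed.exists_root p (by
    intro h0
    have hz : ∀ n, 0 < n → p.coeff n = 0 := fun n hn =>
      Polynomial.coeff_eq_zero_of_degree_lt (by rw [h0]; exact_mod_cast hn)
    have h1 := hz 1 (by norm_num)
    have h2 := hz 2 (by norm_num)
    have h3 := hz 3 (by norm_num)
    simp [p, Polynomial.coeff_C, Polynomial.coeff_X_pow] at h1 h2 h3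
    tauto)
  have hr' : a * r ^ 3 + b * r ^ 2 + c * r + d = 0 := by simpa [p] using hr
  refine ⟨r, ?_, hr'⟩
  rintro rfl
  exact hd (by simpa using hr')

/-- Even sextics. -/
lemma equivForm_of_even {a : ℕ → ℂ} (ha : Stable (sextic a)) (h1 : a 1 = 0) (h3 : a 3 = 0)
    (h5 : a 5 = 0) :
    ∃ lam₁ mu₁ lam₂ mu₂ : ℂ, (lam₁, mu₁) ≠ (0, 0) ∧ (lam₂, mu₂) ≠ (0, 0) ∧
      EquivForm (sextic a) ((Px ^ 2 + Py ^ 2) * (C lam₁ * Px ^ 2 + C mu₁ * Py ^ 2) *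
        (C lam₂ * Px ^ 2 + C mu₂ * Py ^ 2)) := by
  have hlow : a 0 ≠ 0 ∨ a 2 ≠ 0 := by simpa [h1] using ha.low
  have hhigh : a 4 ≠ 0 ∨ a 6 ≠ 0 := by simpa [h5] using ha.high
  obtain ⟨r, hr0, hr⟩ : ∃ r : ℂ, r ≠ 0 ∧ a 6 * r ^ 3 + a 4 * r ^ 2 + a 2 * r + a 0 = 0 := by
    by_cases h0 : a 0 = 0
    · obtain ⟨r, hr0, hr⟩ := exists_ne_zero_root (a := 0) (b := a 6) (c := a 4) (d := a 2)
        (by tauto) (by tauto)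
      exact ⟨r, hr0, by linear_combination r * hr + h0⟩
    · exact exists_ne_zero_root h0 (by tauto)
  obtain ⟨p, hp0, hp⟩ := exists_root_pow (neg_ne_zero.mpr hr0) (n := 4) (by norm_num)
  obtain ⟨q, hq⟩ : ∃ q, p * q = 1 := ⟨p⁻¹, mul_inv_cancel₀ hp0⟩
  have hq0 : q ≠ 0 := right_ne_zero_of_mul_eq_one hq
  have hpq : p ^ 4 * q ^ 4 = 1 := by rw [← mul_pow, hq, one_pow]
  have hrq : r * q ^ 4 = -1 := by linear_combination q ^ 4 * hp - hpq
  obtain ⟨l₁, m₁, l₂, m₂, hne₁, hne₂, e₁, e₂, e₃⟩ := exists_factor_quadratic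
    (a := a 6 * p ^ 4) (b := a 4 + r * a 6) (c := (a 2 + r * (a 4 + r * a 6)) * q ^ 4) (by
      by_contra! hn
      obtain ⟨h6, h4, -⟩ := hn
      have h6' : a 6 = 0 := by simpa [hp0] using h6
      rw [h6', mul_zero, add_zero] at h4
      tauto)
  refine ⟨l₁, m₁, l₂, m₂, hne₁, hne₂, equivForm_sextic (p := p) (q := 0) (r := 0) (s := q)
    (c := q ^ 2) (by linear_combination hq) (pow_ne_zero _ hq0) fun x y => ?_⟩
  have c₆ : a 6 * p ^ 6 * q ^ 2 = l₁ * l₂ := by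
    linear_combination e₁ + a 6 * p ^ 4 * (p * q + 1) * hq
  have c₄ : a 4 * p ^ 4 * q ^ 4 = l₁ * l₂ + (l₁ * m₂ + l₂ * m₁) := by
    linear_combination e₁ + e₂ + a 4 * hpq - a 6 * hp
  have c₂ : a 2 * p ^ 2 * q ^ 6 = (l₁ * m₂ + l₂ * m₁) + m₁ * m₂ := by
    linear_combination e₂ + e₃ + a 2 * q ^ 4 * (p * q + 1) * hq - (a 4 + r * a 6) * hrq
  have c₀ : a 0 * q ^ 8 = m₁ * m₂ := by
    linear_combination e₃ + q ^ 8 * hr - q ^ 4 * (a 2 + r * (a 4 + r * a 6)) * hrq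
  simp [Finset.sum_range_succ, h1, h3, h5, Px, Py]
  linear_combination x ^ 6 * c₆ + x ^ 4 * y ^ 2 * c₄ + x ^ 2 * y ^ 4 * c₂ + y ^ 6 * c₀

/-- Diagonal rescaling making two coefficients equal. -/
lemma exists_balance {a b : ℂ} (ha : a ≠ 0) (hb : b ≠ 0) {n : ℕ} (hn : 0 < n) :
    ∃ p q m : ℂ, p * q = 1 ∧ m ≠ 0 ∧ a * q ^ n = m ∧ b * p ^ n = m := by
  obtain ⟨p, hp0, hp⟩ := exists_root_pow (div_ne_zero ha hb) (n := n + n) (by omega)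
  refine ⟨p, p⁻¹, b * p ^ n, mul_inv_cancel₀ hp0, mul_ne_zero hb (pow_ne_zero _ hp0), ?_, rfl⟩
  have h : b * (p ^ n * p ^ n) = a := by rw [← pow_add, hp, mul_div_cancel₀ _ hb]
  rw [← h, inv_pow]
  field_simp

/-- Odd sextics. -/
lemma equivForm_of_odd {a : ℕ → ℂ} (h0 : a 0 = 0) (h2 : a 2 = 0) (h4 : a 4 = 0) (h6 : a 6 = 0)
    (h1 : a 1 ≠ 0) (h5 : a 5 ≠ 0) :
    ∃ lam mu : ℂ, (lam, mu) ≠ (0, 0) ∧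
      EquivForm (sextic a) (Px * Py *
        (C lam * (Px ^ 2 + Py ^ 2) ^ 2 + C mu * (Px ^ 2 - Py ^ 2) ^ 2)) := by
  obtain ⟨p, q, m, hpq, hm, e₁, e₂⟩ := exists_balance h1 h5 (n := 4) (by norm_num)
  refine ⟨(m + a 3 / 2) / 2, (m - a 3 / 2) / 2, ?_, equivForm_sextic (p := p) (q := 0) (r := 0)
    (s := q) (c := 1) (by linear_combination hpq) one_ne_zero fun x y => ?_⟩
  · intro h
    simp only [Prod.mk.injEq] at h
    exact hm (by linear_combination h.1 + h.2)
  · simp [Finset.sum_range_succ, h0, h2, h4, h6, Px, Py]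
    linear_combination x * y ^ 5 * (e₁ + a 1 * q ^ 4 * hpq) +
      x ^ 5 * y * (e₂ + a 5 * p ^ 4 * hpq) +
      a 3 * x ^ 3 * y ^ 3 * (p ^ 2 * q ^ 2 + p * q + 1) * hpq

/-- Sextics in `x³` and `y³`. -/
lemma equivForm_of_mod_three {a : ℕ → ℂ} (h1 : a 1 = 0) (h2 : a 2 = 0) (h4 : a 4 = 0)
    (h5 : a 5 = 0) (h0 : a 0 ≠ 0) (h6 : a 6 ≠ 0) :
    ∃ lam mu : ℂ, (lam, mu) ≠ (0, 0) ∧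
      EquivForm (sextic a)
        (C lam * (Px ^ 3 + Py ^ 3) ^ 2 + C mu * (Px ^ 3 - Py ^ 3) ^ 2) := by
  obtain ⟨p, q, m, hpq, hm, e₁, e₂⟩ := exists_balance h0 h6 (n := 6) (by norm_num)
  refine ⟨(m + a 3 / 2) / 2, (m - a 3 / 2) / 2, ?_, equivForm_sextic (p := p) (q := 0) (r := 0)
    (s := q) (c := 1) (by linear_combination hpq) one_ne_zero fun x y => ?_⟩
  · intro h
    simp only [Prod.mk.injEq] at h
    exact hm (by linear_combination h.1 + h.2)
  · simp [Finset.sum_range_succ, h1, h2, h4, h5, Px, Py]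
    linear_combination y ^ 6 * e₁ + x ^ 6 * e₂ +
      a 3 * x ^ 3 * y ^ 3 * (p ^ 2 * q ^ 2 + p * q + 1) * hpq

lemma equivForm_of_one_six {a : ℕ → ℂ} (h0 : a 0 = 0) (h2 : a 2 = 0) (h3 : a 3 = 0) (h4 : a 4 = 0)
    (h5 : a 5 = 0) (h1 : a 1 ≠ 0) (h6 : a 6 ≠ 0) :
    EquivForm (sextic a) (Px * (Px ^ 5 + Py ^ 5)) := by
  obtain ⟨p, q, m, hpq, hm, e₁, e₂⟩ := exists_balance h1 h6 (n := 5) (by norm_num)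
  refine equivForm_sextic (p := p) (q := 0) (r := 0) (s := q) (c := q / m)
    (by linear_combination hpq) (div_ne_zero (right_ne_zero_of_mul_eq_one hpq) hm) fun x y => ?_
  simp [Finset.sum_range_succ, h0, h2, h3, h4, h5, Px, Py]
  field_simp
  linear_combination x * (y ^ 5 * e₁ + x ^ 5 * e₂) +
    (a 1 * x * y ^ 5 * q ^ 5 + a 6 * x ^ 6 * p ^ 5) * hpq

lemma equivForm_of_zero_five {a : ℕ → ℂ} (h1 : a 1 = 0) (h2 : a 2 = 0) (h3 : a 3 = 0)
    (h4 : a 4 = 0) (h6 : a 6 = 0) (h0 : a 0 ≠ 0) (h5 : a 5 ≠ 0) :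
    EquivForm (sextic a) (Px * (Px ^ 5 + Py ^ 5)) := by
  obtain ⟨p, q, m, hpq, hm, e₁, e₂⟩ := exists_balance h0 (neg_ne_zero.mpr h5) (n := 5)
    (by norm_num)
  refine equivForm_sextic (p := 0) (q := p) (r := -q) (s := 0) (c := p / m)
    (by linear_combination hpq) (div_ne_zero (left_ne_zero_of_mul_eq_one hpq) hm) fun x y => ?_
  simp [Finset.sum_range_succ, h1, h2, h3, h4, h6, Px, Py]
  field_simp
  linear_combination x * (y ^ 5 * e₂ + x ^ 5 * e₁) +
    (-a 5 * x * y ^ 5 * p ^ 5 + a 0 * x ^ 6 * q ^ 5) * hpq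

lemma equivForm_of_two_five {a : ℕ → ℂ} (h0 : a 0 = 0) (h1 : a 1 = 0) (h3 : a 3 = 0)
    (h4 : a 4 = 0) (h6 : a 6 = 0) (h2 : a 2 ≠ 0) (h5 : a 5 ≠ 0) :
    EquivForm (sextic a) (Px ^ 2 * Py * (Px ^ 3 + Py ^ 3)) := by
  obtain ⟨p, q, m, hpq, hm, e₁, e₂⟩ := exists_balance h2 h5 (n := 3) (by norm_num)
  refine equivForm_sextic (p := p) (q := 0) (r := 0) (s := q) (c := q / m)
    (by linear_combination hpq) (div_ne_zero (right_ne_zero_of_mul_eq_one hpq) hm) fun x y => ?_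
  simp [Finset.sum_range_succ, h0, h1, h3, h4, h6, Px, Py]
  field_simp
  linear_combination x ^ 2 * y * (y ^ 3 * e₁ + x ^ 3 * e₂) +
    (a 2 * x ^ 2 * y ^ 4 * q ^ 3 + a 5 * x ^ 5 * y * p ^ 3) * (p * q + 1) * hpq

lemma equivForm_of_one_four {a : ℕ → ℂ} (h0 : a 0 = 0) (h2 : a 2 = 0) (h3 : a 3 = 0)
    (h5 : a 5 = 0) (h6 : a 6 = 0) (h1 : a 1 ≠ 0) (h4 : a 4 ≠ 0) :
    EquivForm (sextic a) (Px ^ 2 * Py * (Px ^ 3 + Py ^ 3)) := by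
  obtain ⟨p, q, m, hpq, hm, e₁, e₂⟩ := exists_balance (neg_ne_zero.mpr h1) h4 (n := 3)
    (by norm_num)
  refine equivForm_sextic (p := 0) (q := p) (r := -q) (s := 0) (c := p / m)
    (by linear_combination hpq) (div_ne_zero (left_ne_zero_of_mul_eq_one hpq) hm) fun x y => ?_
  simp [Finset.sum_range_succ, h0, h2, h3, h5, h6, Px, Py]
  field_simp
  linear_combination x ^ 2 * y * (y ^ 3 * e₂ + x ^ 3 * e₁) +
    (-a 1 * x ^ 5 * y * q ^ 3 + a 4 * x ^ 2 * y ^ 4 * p ^ 3) * (p * q + 1) * hpq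

/-- Exponents at coprime distances cannot all occur in a form with a diagonal symmetry. -/
lemma coeff_eq_zero_of_gcd {a : ℕ → ℂ} {B : SpecialLinearGroup (Fin 2) ℂ}
    (hB : B ∈ Stab (sextic a)) (h10 : B 1 0 = 0) (h01 : B 0 1 = 0) (ht : B 0 0 ^ 2 ≠ 1)
    {i j : ℕ} (hi : i < 7) (hj : j < 7) (hai : a i ≠ 0) (haj : a j ≠ 0)
    (k : ℕ) (hk : k < 7) (hg : Int.gcd (j - i) (k - i) = 1) : a k = 0 := by
  by_contra hak
  have key : ∀ l, l < 7 → a l ≠ 0 → (orderOf (B 0 0 ^ 2) : ℤ) ∣ (l : ℤ) - i := by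
    intro l hl hal
    rcases le_total i l with h | h
    · rw [← Nat.cast_sub h]
      exact_mod_cast orderOf_dvd_of_pow_eq_one (pow_sub_eq_one hB h10 h01 h hl hai hal)
    · rw [← neg_sub, dvd_neg, ← Nat.cast_sub h]
      exact_mod_cast orderOf_dvd_of_pow_eq_one (pow_sub_eq_one hB h10 h01 h hi hal hai)
  have h := Int.dvd_coe_gcd (key j hj haj) (key k hk hak)
  rw [hg] at h
  exact ht (orderOf_eq_one_iff.mp (Nat.dvd_one.mp (by exact_mod_cast h)))

end BinarySextic

/-- Classification of stable binary sextics with extra symmetries: if a binary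
sextic with all roots of multiplicity at most 2 has stabilizer strictly
containing `{I, -I}`, then it is `SL(2,ℂ)`-equivalent up to a nonzero scalar to
one of the eight listed normal forms. -/
theorem stable_sextic_extra_symmetry
    (f : BPoly) (hf0 : f ≠ 0) (hf6 : f.IsHomogeneous 6)
    (hstable : ∀ a b : ℂ, (a, b) ≠ (0, 0) → ¬((C a * Px + C b * Py) ^ 3 ∣ f))
    (hbig : {A : SpecialLinearGroup (Fin 2) ℂ |
      (A : Matrix (Fin 2) (Fin 2) ℂ) = 1 ∨
      (A : Matrix (Fin 2) (Fin 2) ℂ) = -1} ⊂ Stab f) :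
    (∃ lam₁ mu₁ lam₂ mu₂ : ℂ, (lam₁, mu₁) ≠ (0, 0) ∧ (lam₂, mu₂) ≠ (0, 0) ∧
      EquivForm f ((Px ^ 2 + Py ^ 2) * (C lam₁ * Px ^ 2 + C mu₁ * Py ^ 2) *
        (C lam₂ * Px ^ 2 + C mu₂ * Py ^ 2))) ∨
    EquivForm f (Px * (Px ^ 5 + Py ^ 5)) ∨
    (∃ lam mu : ℂ, (lam, mu) ≠ (0, 0) ∧
      EquivForm f (Px * Py *
        (C lam * (Px ^ 2 + Py ^ 2) ^ 2 + C mu * (Px ^ 2 - Py ^ 2) ^ 2))) ∨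
    (∃ lam mu : ℂ, (lam, mu) ≠ (0, 0) ∧
      EquivForm f
        (C lam * (Px ^ 3 + Py ^ 3) ^ 2 + C mu * (Px ^ 3 - Py ^ 3) ^ 2)) ∨
    EquivForm f (Px ^ 6 + Py ^ 6) ∨
    EquivForm f (Px * Py * (Px ^ 4 - Py ^ 4)) ∨
    EquivForm f (Px ^ 2 * Py * (Px ^ 3 + Py ^ 3)) ∨
    EquivForm f (Px ^ 2 * (Px ^ 4 + Py ^ 4)) := by
  have hf : BinarySextic.Stable f := hstable
  obtain ⟨A, hA, hA'⟩ := Set.exists_of_ssubset hbig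
  simp only [Set.mem_ofPred_eq, not_or] at hA'
  obtain ⟨P, B, hB, h10, h01, ht⟩ := BinarySextic.exists_diag_symmetry hf6 hf hA
    (fun h => hA'.1 (by rw [h]; rfl)) (fun h => hA'.2 (by rw [h]; rfl))
  obtain ⟨a, ha⟩ := BinarySextic.exists_eq_sextic
    (BinarySextic.isHomogeneous_matAct (P : Matrix (Fin 2) (Fin 2) ℂ) hf6)
  have hst := hf.matAct P
  rw [ha] at hst hB
  have back : ∀ {g : BPoly}, EquivForm (BinarySextic.sextic a) g → EquivForm f g := fun h =>
    BinarySextic.EquivForm.of_matAct P (ha ▸ h)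
  have even : a 1 = 0 → a 3 = 0 → a 5 = 0 → _ := fun h1 h3 h5 =>
    let ⟨l₁, m₁, l₂, m₂, n₁, n₂, h⟩ := BinarySextic.equivForm_of_even hst h1 h3 h5
    (⟨l₁, m₁, l₂, m₂, n₁, n₂, back h⟩ : ∃ lam₁ mu₁ lam₂ mu₂ : ℂ, (lam₁, mu₁) ≠ (0, 0) ∧
      (lam₂, mu₂) ≠ (0, 0) ∧
      EquivForm f ((Px ^ 2 + Py ^ 2) * (C lam₁ * Px ^ 2 + C mu₁ * Py ^ 2) *
        (C lam₂ * Px ^ 2 + C mu₂ * Py ^ 2)))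
  have vanish : ∀ {i j : ℕ}, a i ≠ 0 → a j ≠ 0 → i < 7 → j < 7 → ∀ k : ℕ, k < 7 →
      Int.gcd (j - i) (k - i) = 1 → a k = 0 := fun hai haj hi hj =>
    BinarySextic.coeff_eq_zero_of_gcd hB h10 h01 ht hi hj hai haj
  rcases hst.low with hi | hi | hi <;> rcases hst.high with hj | hj | hj <;>
    have Z := vanish hi hj (by norm_num) (by norm_num)
  · exact .inl (even (Z 1 (by norm_num) (by decide)) (Z 3 (by norm_num) (by decide))
      (Z 5 (by norm_num) (by decide)))
  · exact .inr (.inl (back (BinarySextic.equivForm_of_zero_five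
      (Z 1 (by norm_num) (by decide)) (Z 2 (by norm_num) (by decide))
      (Z 3 (by norm_num) (by decide)) (Z 4 (by norm_num) (by decide))
      (Z 6 (by norm_num) (by decide)) hi hj)))
  · have h1 := Z 1 (by norm_num) (by decide)
    have h5 := Z 5 (by norm_num) (by decide)
    by_cases h2 : a 2 = 0
    · by_cases h4 : a 4 = 0
      · obtain ⟨l, m, n, h⟩ := BinarySextic.equivForm_of_mod_three h1 h2 h4 h5 hi hj
        exact .inr (.inr (.inr (.inl ⟨l, m, n, back h⟩)))
      · exact .inl (even h1 (vanish hi h4 (by norm_num) (by norm_num) 3 (by norm_num) (by decide))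
          h5)
    · exact .inl (even h1 (vanish hi h2 (by norm_num) (by norm_num) 3 (by norm_num) (by decide)) h5)
  · exact .inr (.inr (.inr (.inr (.inr (.inr (.inl (back (BinarySextic.equivForm_of_one_four
      (Z 0 (by norm_num) (by decide)) (Z 2 (by norm_num) (by decide))
      (Z 3 (by norm_num) (by decide)) (Z 5 (by norm_num) (by decide))
      (Z 6 (by norm_num) (by decide)) hi hj))))))))
  · obtain ⟨l, m, n, h⟩ := BinarySextic.equivForm_of_odd
      (Z 0 (by norm_num) (by decide)) (Z 2 (by norm_num) (by decide))
      (Z 4 (by norm_num) (by decide)) (Z 6 (by norm_num) (by decide)) hi hj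
    exact .inr (.inr (.inl ⟨l, m, n, back h⟩))
  · exact .inr (.inl (back (BinarySextic.equivForm_of_one_six
      (Z 0 (by norm_num) (by decide)) (Z 2 (by norm_num) (by decide))
      (Z 3 (by norm_num) (by decide)) (Z 4 (by norm_num) (by decide))
      (Z 5 (by norm_num) (by decide)) hi hj)))
  · exact .inl (even (Z 1 (by norm_num) (by decide)) (Z 3 (by norm_num) (by decide))
      (Z 5 (by norm_num) (by decide)))
  · exact .inr (.inr (.inr (.inr (.inr (.inr (.inl (back (BinarySextic.equivForm_of_two_five
      (Z 0 (by norm_num) (by decide)) (Z 1 (by norm_num) (by decide))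
      (Z 3 (by norm_num) (by decide)) (Z 4 (by norm_num) (by decide))
      (Z 6 (by norm_num) (by decide)) hi hj))))))))
  · exact .inl (even (Z 1 (by norm_num) (by decide)) (Z 3 (by norm_num) (by decide))
      (Z 5 (by norm_num) (by decide)))

end
end

section
/- Let ζ ∈ ℂ be a primitive 8th root of unity. The stabilizer Stab(x⁴+y⁴) ⊂ SL(2,ℂ) equals the subgroup generated by diag(ζ, ζ⁻¹) and [[0,i],[i,0]] (the binary dihedral group D₄, of order 16). -/
open MvPolynomial Matrix

noncomputable section

/-- The subgroup of `SL(2,ℂ)` of diagonal and antidiagonal matrices whose entries are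
eighth roots of unity. -/
def monomialSubgroup : Subgroup (SpecialLinearGroup (Fin 2) ℂ) where
  carrier := {A | ∃ u : ℂ, u ^ 8 = 1 ∧
    ((A : Matrix (Fin 2) (Fin 2) ℂ) = !![u, 0; 0, u⁻¹] ∨
      (A : Matrix (Fin 2) (Fin 2) ℂ) = !![0, u; -u⁻¹, 0])}
  one_mem' := ⟨1, by norm_num, Or.inl (by simp [Matrix.one_fin_two])⟩
  mul_mem' := by
    rintro A B ⟨u, hu, hA⟩ ⟨v, hv, hB⟩
    rcases hA with hA | hA <;> rcases hB with hB | hB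
    · refine ⟨u * v, by rw [mul_pow, hu, hv, one_mul], Or.inl ?_⟩
      simp [hA, hB, mul_comm]
    · refine ⟨u * v, by rw [mul_pow, hu, hv, one_mul], Or.inr ?_⟩
      simp [hA, hB, mul_comm]
    · refine ⟨u * v⁻¹, by rw [mul_pow, inv_pow, hu, hv, inv_one, one_mul], Or.inr ?_⟩
      simp [hA, hB, mul_comm]
    · refine ⟨-(u * v⁻¹), ?_, Or.inl ?_⟩
      · rw [Even.neg_pow (by decide), mul_pow, inv_pow, hu, hv, inv_one, one_mul]
      · simp [hA, hB, mul_comm, inv_neg]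
  inv_mem' := by
    rintro A ⟨u, hu, hA | hA⟩
    · refine ⟨u⁻¹, by rw [inv_pow, hu, inv_one], Or.inl ?_⟩
      simp [hA, adjugate_fin_two_of]
    · refine ⟨-u, by rw [Even.neg_pow (by decide), hu], Or.inr ?_⟩
      simp [hA, adjugate_fin_two_of, inv_neg]

theorem mem_monomialSubgroup {A : SpecialLinearGroup (Fin 2) ℂ} :
    A ∈ monomialSubgroup ↔ ∃ u : ℂ, u ^ 8 = 1 ∧
      ((A : Matrix (Fin 2) (Fin 2) ℂ) = !![u, 0; 0, u⁻¹] ∨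
        (A : Matrix (Fin 2) (Fin 2) ℂ) = !![0, u; -u⁻¹, 0]) :=
  Iff.rfl

/-- A unimodular substitution that keeps `x⁴ + y⁴` free of mixed terms is diagonal or
antidiagonal. -/
theorem diagonal_or_antidiagonal {p q r s : ℂ} (hdet : p * s - q * r = 1)
    (h₃ : p ^ 3 * q + r ^ 3 * s = 0) (h₂ : p ^ 2 * q ^ 2 + r ^ 2 * s ^ 2 = 0)
    (h₁ : p * q ^ 3 + r * s ^ 3 = 0) :
    (q = 0 ∧ r = 0) ∨ (p = 0 ∧ s = 0) := by
  have hsum : p * q * (p * s + q * r) = 0 := by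
    linear_combination s ^ 2 * h₃ - r ^ 2 * h₁ - p * q * (p * s + q * r) * hdet
  have hpq : p * q = 0 := by
    have hps : p * q * (2 * (p * s) - 1) = 0 := by
      linear_combination hsum + p * q * hdet
    linear_combination 2 * (s ^ 2 * h₃ - r * s * h₂ - p * q * (p * s) * hdet) - hps
  have hrs : r * s = 0 := by
    refine pow_eq_zero_iff two_ne_zero |>.1 ?_
    linear_combination h₂ - p * q * hpq
  rcases mul_eq_zero.1 hpq with rfl | rfl <;> rcases mul_eq_zero.1 hrs with rfl | rfl
  · norm_num at hdet
  · exact Or.inr ⟨rfl, rfl⟩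
  · exact Or.inl ⟨rfl, rfl⟩
  · norm_num at hdet

theorem semiInv_fermat_iff (A : Matrix (Fin 2) (Fin 2) ℂ) :
    SemiInv A (Px ^ 4 + Py ^ 4) ↔ ∃ c : ℂ, c ≠ 0 ∧
      (C (A 0 0) * Px + C (A 0 1) * Py) ^ 4 + (C (A 1 0) * Px + C (A 1 1) * Py) ^ 4 =
        C c * (Px ^ 4 + Py ^ 4) := by
  simp [SemiInv, matAct, Px, Py]

theorem stab_fermat_eq_monomialSubgroup :
    Stab (Px ^ 4 + Py ^ 4) = (monomialSubgroup : Set (SpecialLinearGroup (Fin 2) ℂ)) := by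
  ext A
  rw [SetLike.mem_coe, mem_monomialSubgroup]
  change SemiInv _ _ ↔ _
  rw [semiInv_fermat_iff]
  constructor
  · rintro ⟨c, -, h⟩
    have hdet := A.det_coe
    rw [det_fin_two] at hdet
    have heval (x y : ℂ) : (A 0 0 * x + A 0 1 * y) ^ 4 + (A 1 0 * x + A 1 1 * y) ^ 4 =
        c * (x ^ 4 + y ^ 4) := by
      simpa [Px, Py] using congrArg (MvPolynomial.eval ![x, y]) h
    have hA := Matrix.eta_fin_two (A : Matrix (Fin 2) (Fin 2) ℂ)
    generalize A 0 0 = p, A 0 1 = q, A 1 0 = r, A 1 1 = s at hdet heval hA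
    have e₁ := heval 1 0
    have e₂ := heval 0 1
    have e₃ := heval 1 1
    have e₄ := heval 1 (-1)
    have e₅ := heval 1 2
    have h₂ : p ^ 2 * q ^ 2 + r ^ 2 * s ^ 2 = 0 := by
      linear_combination (e₃ + e₄ - 2 * e₁ - 2 * e₂) / 12
    have h₁ : p * q ^ 3 + r * s ^ 3 = 0 := by
      linear_combination (e₅ - e₁ - 16 * e₂ - 24 * h₂ - (e₃ - e₄)) / 24
    have h₃ : p ^ 3 * q + r ^ 3 * s = 0 := by
      linear_combination (e₃ - e₄) / 8 - h₁
    rcases diagonal_or_antidiagonal hdet h₃ h₂ h₁ with ⟨rfl, rfl⟩ | ⟨rfl, rfl⟩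
    · have hps : p * s = 1 := by linear_combination hdet
      refine ⟨p, ?_, Or.inl ?_⟩
      · linear_combination p ^ 4 * (e₁ - e₂) + (p ^ 3 * s ^ 3 + p ^ 2 * s ^ 2 + p * s + 1) * hps
      · rw [hA, eq_inv_of_mul_eq_one_right hps]
    · have hqr : q * -r = 1 := by linear_combination hdet
      refine ⟨q, ?_, Or.inr ?_⟩
      · linear_combination q ^ 4 * (e₂ - e₁) + (q ^ 2 * r ^ 2 + 1) * (1 - q * r) * hqr
      · rw [hA, ← eq_inv_of_mul_eq_one_right hqr, neg_neg]
  · rintro ⟨u, hu, hA⟩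
    have hu0 : u ≠ 0 := by
      rintro rfl
      norm_num at hu
    have hinv : (u⁻¹) ^ 4 = u ^ 4 := by
      rw [inv_pow, inv_eq_iff_eq_inv]
      exact eq_inv_of_mul_eq_one_left (by rw [← pow_add, hu])
    have hC : (C u⁻¹ : BPoly) ^ 4 = C u ^ 4 := by rw [← C_pow, ← C_pow, hinv]
    refine ⟨u ^ 4, pow_ne_zero _ hu0, ?_⟩
    rcases hA with hA | hA
    · simp only [hA, of_apply, cons_val', cons_val_zero, cons_val_one, cons_val_fin_one,
        C_0, C_pow]
      linear_combination Py ^ 4 * hC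
    · simp only [hA, of_apply, cons_val', cons_val_zero, cons_val_one, cons_val_fin_one,
        C_0, C_pow, C_neg]
      linear_combination Px ^ 4 * hC

/-- The stabilizer of `x⁴+y⁴` in `SL(2,ℂ)` is the binary dihedral group `D₄` of
order 16, generated by `diag(ζ, ζ⁻¹)` (`ζ` a primitive 8th root of unity) and
`[[0,i],[i,0]]`. -/
theorem stab_quartic_fermat
    (ζ : ℂ) (hζ : IsPrimitiveRoot ζ 8)
    (D S : SpecialLinearGroup (Fin 2) ℂ)
    (hD : (D : Matrix (Fin 2) (Fin 2) ℂ) = !![ζ, 0; 0, ζ⁻¹])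
    (hS : (S : Matrix (Fin 2) (Fin 2) ℂ) = !![0, Complex.I; Complex.I, 0]) :
    Stab (Px ^ 4 + Py ^ 4) = ↑(Subgroup.closure {D, S}) ∧
    Nat.card (Subgroup.closure {D, S} : Subgroup (SpecialLinearGroup (Fin 2) ℂ)) = 16 := by
  have hDpow (k : ℕ) : ((D ^ k : SpecialLinearGroup (Fin 2) ℂ) : Matrix (Fin 2) (Fin 2) ℂ) =
      !![ζ ^ k, 0; 0, (ζ ^ k)⁻¹] := by
    induction k with
    | zero => simp [Matrix.one_fin_two]
    | succ k ih => simp [pow_succ, ih, hD, mul_comm]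
  have hDS (k : ℕ) : ((D ^ k * S : SpecialLinearGroup (Fin 2) ℂ) : Matrix (Fin 2) (Fin 2) ℂ) =
      !![0, ζ ^ k * Complex.I; (ζ ^ k)⁻¹ * Complex.I, 0] := by
    simp [hDpow, hS]
  have hI8 : Complex.I ^ 8 = 1 := by
    rw [show 8 = 4 * 2 from rfl, pow_mul, Complex.I_pow_four, one_pow]
  let word : Fin 8 ⊕ Fin 8 → SpecialLinearGroup (Fin 2) ℂ :=
    Sum.elim (fun k => D ^ (k : ℕ)) (fun k => D ^ (k : ℕ) * S)
  have hDmem : D ∈ Subgroup.closure {D, S} := Subgroup.subset_closure (by simp)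
  have hSmem : S ∈ Subgroup.closure {D, S} := Subgroup.subset_closure (by simp)
  have hle : Subgroup.closure {D, S} ≤ monomialSubgroup := by
    rw [Subgroup.closure_le]
    rintro A (rfl | rfl)
    · exact ⟨ζ, hζ.pow_eq_one, Or.inl hD⟩
    · exact ⟨Complex.I, hI8, Or.inr (by simp [hS])⟩
  have hrange_le : Set.range word ⊆ Subgroup.closure {D, S} := by
    rintro _ ⟨k | k, rfl⟩
    · exact pow_mem hDmem _
    · exact mul_mem (pow_mem hDmem _) hSmem
  have hle_range : (monomialSubgroup : Set (SpecialLinearGroup (Fin 2) ℂ)) ⊆ Set.range word := by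
    rintro A ⟨u, hu, hA | hA⟩
    · obtain ⟨k, hk, rfl⟩ := hζ.eq_pow_of_pow_eq_one hu
      exact ⟨Sum.inl ⟨k, hk⟩, Subtype.ext ((hDpow k).trans hA.symm)⟩
    · obtain ⟨k, hk, hku⟩ := hζ.eq_pow_of_pow_eq_one
        (show (u * Complex.I⁻¹) ^ 8 = 1 by rw [mul_pow, inv_pow, hu, hI8, inv_one, one_mul])
      refine ⟨Sum.inr ⟨k, hk⟩, Subtype.ext ((hDS k).trans ?_)⟩
      rw [hA, hku]
      simp only [mul_inv, inv_inv, mul_assoc, inv_mul_cancel₀ Complex.I_ne_zero, mul_one,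
        Complex.I_mul_I, mul_neg]
  have hword : Function.Injective word := by
    have hentry {k l : Fin 8} (h : ζ ^ (k : ℕ) = ζ ^ (l : ℕ)) : k = l :=
      Fin.ext (hζ.pow_inj k.isLt l.isLt h)
    have hζ0 : ζ ≠ 0 := hζ.ne_zero (by norm_num)
    rintro (k | k) (l | l) h <;>
      replace h := congrArg Subtype.val h <;>
      simp only [word, Sum.elim_inl, Sum.elim_inr, hDpow, hDS] at h
    · exact congrArg Sum.inl (hentry (by simpa using congrFun (congrFun h 0) 0))
    · exact absurd (congrFun (congrFun h 0) 0) (by simp [hζ0])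
    · exact absurd (congrFun (congrFun h 0) 0) (by simp [eq_comm, hζ0])
    · exact congrArg Sum.inr (hentry (by simpa using congrFun (congrFun h 0) 1))
  have hclosure : (Subgroup.closure {D, S} : Set (SpecialLinearGroup (Fin 2) ℂ)) =
      Set.range word :=
    (SetLike.coe_subset_coe.2 hle |>.trans hle_range).antisymm hrange_le
  constructor
  · rw [stab_fermat_eq_monomialSubgroup]
    exact (hle_range.trans hrange_le).antisymm hle
  · change Nat.card ((Subgroup.closure {D, S} : Set (SpecialLinearGroup (Fin 2) ℂ))) = 16
    rw [hclosure, Nat.card_range_of_injective hword]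
    simp

end
end
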